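/- Let 13/14 < γ < 1 be fixed and ε > 0. Suppose α is irrational and β is real, and a, q are integers with q ≥ 2, gcd(a,q) = 1, a ≠ 0 and |α − a/q| < 1/q². Set N = q^{29/(55−28γ)} and Δ = C N^{(13−14γ)/29 + ε} for a sufficiently large constant C > 0. Then for q sufficiently large, Γ₂ = Σ_{p ≤ N} ( ψ(−(p+1)^γ) − ψ(−p^γ) ) ( F_Δ(αp² + β) − 2Δ ) log p satisfies Γ₂ ≪ N^{(15γ+13)/29 + ε}, where the sum is over primes p ≤ N and the implied constant depends only on γ and ε. -/

import Mathlib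

/-- `Fdelta Δ` is the 1-periodic function equal to `1` on `[-Δ, Δ)` and `0` on the rest
of `[-1/2, 1/2)` (using the representative of `θ` modulo one lying in `[-1/2, 1/2)`). -/
noncomputable def Fdelta (Δ θ : ℝ) : ℝ :=
  if -Δ ≤ Int.fract (θ + 1 / 2) - 1 / 2 ∧ Int.fract (θ + 1 / 2) - 1 / 2 < Δ then 1 else 0

/-- `psi t = {t} - 1/2`. -/
noncomputable def psi (t : ℝ) : ℝ := Int.fract t - 1 / 2

section

open Real Finset

/-- The additive character `e(x) = exp(2πix)`. -/
noncomputable def expi (x : ℝ) : ℂ := Complex.exp ((2 * π * x : ℝ) * Complex.I)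

lemma norm_expi (x : ℝ) : ‖expi x‖ = 1 := Complex.norm_exp_ofReal_mul_I _

lemma expi_add (x y : ℝ) : expi (x + y) = expi x * expi y := by
  unfold expi
  rw [← Complex.exp_add]
  congr 1
  push_cast
  ring

lemma expi_zero : expi 0 = 1 := by simp [expi]

lemma conj_expi (x : ℝ) : (starRingEnd ℂ) (expi x) = expi (-x) := by
  unfold expi
  rw [← Complex.exp_conj]
  congr 1
  rw [map_mul, Complex.conj_ofReal, Complex.conj_I]
  push_cast
  ring

lemma expi_int (k : ℤ) : expi k = 1 := by
  unfold expi
  rw [Complex.exp_eq_one_iff]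
  exact ⟨k, by push_cast; ring⟩

lemma expi_eq_cos_sin (x : ℝ) :
    expi x = (Real.cos (2 * π * x) : ℂ) + (Real.sin (2 * π * x) : ℂ) * Complex.I := by
  unfold expi
  rw [Complex.exp_mul_I]
  simp

lemma norm_sum_expi_neg {ι : Type*} (s : Finset ι) (f : ι → ℝ) :
    ‖∑ i ∈ s, expi (-f i)‖ = ‖∑ i ∈ s, expi (f i)‖ := by
  rw [← RCLike.norm_conj (∑ i ∈ s, expi (f i)), map_sum]
  simp_rw [conj_expi]

/-- With `w = (1 + i cot πt) / 2` we have `w (1 - e(t)) = 1`. -/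
lemma one_add_expi_mul {t : ℝ} (ht : Real.sin (π * t) ≠ 0) :
    1 + expi t * (1 / 2 + Complex.I / 2 * (Real.cos (π * t) / Real.sin (π * t) : ℝ)) =
      1 / 2 + Complex.I / 2 * (Real.cos (π * t) / Real.sin (π * t) : ℝ) := by
  rw [expi_eq_cos_sin, show 2 * π * t = 2 * (π * t) by ring, Real.cos_two_mul, Real.sin_two_mul]
  set c := Real.cos (π * t)
  set s := Real.sin (π * t)
  have h : (c : ℂ) ^ 2 + (s : ℂ) ^ 2 = 1 := by
    exact_mod_cast Real.cos_sq_add_sin_sq (π * t)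
  have hs : (s : ℂ) ≠ 0 := by exact_mod_cast ht
  have hI : Complex.I ^ 2 = -1 := Complex.I_sq
  push_cast
  field_simp
  linear_combination (2 * Complex.I * c) * h + 2 * (s : ℂ) * (c : ℂ) ^ 2 * hI

lemma cot_monotone {s t : ℝ} (hs : 0 < s) (hst : s ≤ t) (ht : t ≤ 1 / 2) :
    Real.cos (π * t) / Real.sin (π * t) ≤ Real.cos (π * s) / Real.sin (π * s) := by
  have hp := Real.pi_pos
  have h1 : π * s ≤ π * t := by gcongr
  have h2 : π * t ≤ π / 2 := by nlinarith
  have h3 : 0 < π * s := by positivity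
  have h4 : 0 < Real.sin (π * s) := Real.sin_pos_of_pos_of_lt_pi h3 (by linarith)
  apply div_le_div₀
  · exact Real.cos_nonneg_of_neg_pi_div_two_le_of_le (by linarith) (by linarith)
  · exact Real.cos_le_cos_of_nonneg_of_le_pi h3.le (by linarith) h1
  · exact h4
  · exact Real.sin_le_sin_of_le_of_le_pi_div_two (by linarith) h2 h1

/-- The Kusmin–Landau inequality. -/
lemma kusmin_landau (f : ℕ → ℝ) (lam : ℝ) (n : ℕ) (hlam : 0 < lam)
    (hlo : ∀ m < n, lam ≤ f (m + 1) - f m) (hhi : ∀ m < n, f (m + 1) - f m ≤ 1 / 2)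
    (hanti : ∀ m, m + 1 < n → f (m + 2) - f (m + 1) ≤ f (m + 1) - f m) :
    ‖∑ m ∈ range n, expi (f m)‖ ≤ 1 / lam := by
  have hp := Real.pi_pos
  set t : ℕ → ℝ := fun m => f (m + 1) - f m with ht
  set c : ℕ → ℝ := fun m => Real.cos (π * t m) / Real.sin (π * t m) with hc
  set w : ℕ → ℂ := fun m => 1 / 2 + Complex.I / 2 * (c m : ℝ) with hw
  have hsin : ∀ m < n, 2 * lam ≤ Real.sin (π * t m) := by
    intro m hm
    have h1 := hlo m hm
    have h2 := hhi m hm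
    have := Real.mul_le_sin (x := π * t m) (by have : 0 < t m := by linarith
                                               positivity) (by nlinarith)
    have e : 2 / π * (π * t m) = 2 * t m := by field_simp
    rw [e] at this
    linarith
  have hc0 : ∀ m < n, 0 ≤ c m := by
    intro m hm
    have h1 := hlo m hm
    have h2 := hhi m hm
    have h3 : 0 < t m := by linarith
    refine div_nonneg ?_ (by linarith [hsin m hm])
    have : 0 < π * t m := by positivity
    exact Real.cos_nonneg_of_neg_pi_div_two_le_of_le (by linarith) (by nlinarith)
  have hc1 : ∀ m < n, c m ≤ 1 / (2 * lam) := by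
    intro m hm
    have := hsin m hm
    apply div_le_div₀ zero_le_one (Real.cos_le_one _) (by positivity) this
  have hmono : ∀ m, m + 1 < n → c m ≤ c (m + 1) := by
    intro m hm
    exact cot_monotone (by have := hlo (m+1) hm; simp only [ht]; linarith) (hanti m hm)
      (hhi m (by omega))
  have hz : ∀ m, expi (f (m + 1)) = expi (f m) * expi (t m) := by
    intro m
    rw [← expi_add]; congr 1; simp [ht]
  have key : ∀ k, k < n → ‖∑ m ∈ range (k + 1), expi (f m) + expi (f (k + 1)) * w k
      - expi (f 0) * w 0‖ ≤ (c k - c 0) / 2 := by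
    intro k
    induction k with
    | zero =>
      intro hk
      have := one_add_expi_mul (t := t 0) (by linarith [hsin 0 hk])
      have e : ∑ m ∈ range (0 + 1), expi (f m) + expi (f (0 + 1)) * w 0 - expi (f 0) * w 0 = 0 := by
        rw [hz 0]
        simp only [zero_add, sum_range_one]
        linear_combination expi (f 0) * this
      rw [e]; simp
    | succ k ih =>
      intro hk
      have h1 := ih (by omega)
      have := one_add_expi_mul (t := t (k + 1)) (by linarith [hsin _ hk])
      have e : ∑ m ∈ range (k + 1 + 1), expi (f m) + expi (f (k + 1 + 1)) * w (k + 1)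
          - expi (f 0) * w 0 = (∑ m ∈ range (k + 1), expi (f m) + expi (f (k + 1)) * w k
            - expi (f 0) * w 0) + expi (f (k + 1)) * (w (k + 1) - w k) := by
        rw [hz (k + 1), sum_range_succ _ (k + 1)]
        linear_combination expi (f (k + 1)) * this
      rw [e]
      have h2 : ‖expi (f (k + 1)) * (w (k + 1) - w k)‖ = (c (k + 1) - c k) / 2 := by
        have : w (k + 1) - w k = Complex.I * (((c (k + 1) - c k) / 2 : ℝ) : ℂ) := by
          simp only [hw]; push_cast; ring
        rw [this, norm_mul, norm_expi, norm_mul, Complex.norm_I, Complex.norm_real,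
          Real.norm_of_nonneg (by linarith [hmono k hk])]
        ring
      refine (norm_add_le _ _).trans ?_
      rw [h2]; linarith
  have hwn : ∀ m < n, ‖w m‖ ≤ 1 / 2 + c m / 2 := by
    intro m hm
    refine (norm_add_le _ _).trans ?_
    rw [norm_mul, Complex.norm_real, Real.norm_of_nonneg (hc0 m hm)]
    simp
    linarith
  rcases n with _ | n
  · simp; positivity
  have h1 := key n (by omega)
  have h2 : ∑ m ∈ range (n + 1), expi (f m) = (∑ m ∈ range (n + 1), expi (f m)
      + expi (f (n + 1)) * w n - expi (f 0) * w 0) - expi (f (n + 1)) * w n + expi (f 0) * w 0 := by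
    ring
  rw [h2]
  refine (norm_add_le _ _).trans ?_
  have h3 := norm_sub_le (∑ m ∈ range (n + 1), expi (f m)
      + expi (f (n + 1)) * w n - expi (f 0) * w 0) (expi (f (n + 1)) * w n)
  rw [norm_mul, norm_expi] at h3
  rw [norm_mul, norm_expi]
  have h4 := hwn n (by omega)
  have h5 := hwn 0 (by omega)
  have h6 := hc1 n (by omega)
  have h7 : lam ≤ 1 / 2 := (hlo 0 (by omega)).trans (hhi 0 (by omega))
  have h8 : 1 / lam = 1 / (2 * lam) + 1 / (2 * lam) := by field_simp; norm_num
  have h9 : 1 ≤ 1 / (2 * lam) := by rw [le_div_iff₀ (by positivity)]; linarith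
  rw [h8]; linarith

/-- The square of a sum expressed through correlations. -/
lemma norm_sq_sum_range (z : ℕ → ℂ) (L : ℕ) :
    ‖∑ i ∈ range L, z i‖ ^ 2 = ∑ i ∈ range L, ‖z i‖ ^ 2 +
      2 * (∑ r ∈ range L, ∑ i ∈ range (L - (r + 1)),
        z (i + (r + 1)) * (starRingEnd ℂ) (z i)).re := by
  induction L with
  | zero => simp
  | succ L ih =>
    have h1 : ∑ r ∈ range (L + 1), ∑ i ∈ range (L + 1 - (r + 1)),
        z (i + (r + 1)) * (starRingEnd ℂ) (z i) =
        ∑ r ∈ range L, ∑ i ∈ range (L - (r + 1)), z (i + (r + 1)) * (starRingEnd ℂ) (z i)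
          + z L * (starRingEnd ℂ) (∑ i ∈ range L, z i) := by
      rw [sum_range_succ]
      simp only [Nat.sub_self, range_zero, sum_empty, add_zero]
      rw [map_sum, mul_sum, ← sum_range_reflect (fun i => z L * (starRingEnd ℂ) (z i)) L,
        ← sum_add_distrib]
      refine sum_congr rfl fun j hj => ?_
      have hj' := mem_range.mp hj
      have e : L + 1 - (j + 1) = (L - (j + 1)) + 1 := by omega
      rw [e, sum_range_succ, show L - (j + 1) + (j + 1) = L by omega,
        show L - (j + 1) = L - 1 - j by omega]
    rw [h1, sum_range_succ, sum_range_succ, Complex.add_re, mul_add, ← add_assoc]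
    have h2 := Complex.normSq_add (∑ i ∈ range L, z i) (z L)
    rw [Complex.normSq_eq_norm_sq, Complex.normSq_eq_norm_sq, Complex.normSq_eq_norm_sq, ih] at h2
    rw [h2]
    have h3 : (z L * (starRingEnd ℂ) (∑ i ∈ range L, z i)).re =
        ((∑ i ∈ range L, z i) * (starRingEnd ℂ) (z L)).re := by
      rw [Complex.mul_re, Complex.mul_re, Complex.conj_re, Complex.conj_im, Complex.conj_re,
        Complex.conj_im]; ring
    rw [h3]; ring

/-- Weyl differencing. -/
lemma weyl_differencing (f : ℕ → ℝ) (L : ℕ) :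
    ‖∑ i ∈ range L, expi (f i)‖ ^ 2 ≤ L +
      2 * ∑ r ∈ range L, ‖∑ i ∈ range (L - (r + 1)), expi (f (i + (r + 1)) - f i)‖ := by
  rw [norm_sq_sum_range]
  have h1 : ∑ i ∈ range L, ‖expi (f i)‖ ^ 2 = L := by simp [norm_expi]
  rw [h1]
  gcongr
  refine (Complex.re_le_norm _).trans ((norm_sum_le _ _).trans (le_of_eq ?_))
  simp_rw [conj_expi, ← expi_add, ← sub_eq_add_neg]

/-- Iterated forward differences with the steps in `l`. -/
def iterDiff : List ℝ → (ℝ → ℝ) → ℝ → ℝ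
  | [], f => f
  | r :: l, f => fun x => iterDiff l f (x + r) - iterDiff l f x

lemma hasDerivAt_iterDiff_rpow (l : List ℝ) (hl : ∀ r ∈ l, 0 < r) (c : ℝ) :
    ∀ x > 0, HasDerivAt (iterDiff l (fun x => x ^ c))
      (c * iterDiff l (fun x => x ^ (c - 1)) x) x := by
  induction l with
  | nil =>
    intro x hx
    simpa [iterDiff] using Real.hasDerivAt_rpow_const (p := c) (Or.inl hx.ne')
  | cons r l ih =>
    intro x hx
    have hr : 0 < r := hl r (by simp)
    have ih' := ih (fun s hs => hl s (by simp [hs]))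
    have h1 := (ih' (x + r) (by positivity)).comp_add_const x r
    have h2 := ih' x hx
    have := h1.sub h2
    simp only [iterDiff]
    rw [mul_sub]
    exact this

/-- The mean value theorem for iterated differences of a power function. -/
lemma exists_iterDiff_rpow_eq (l : List ℝ) (hl : ∀ r ∈ l, 0 < r) (c : ℝ) :
    ∀ x > 0, ∃ ξ, x ≤ ξ ∧ ξ ≤ x + l.sum ∧ iterDiff l (fun x => x ^ c) x =
      l.prod * (∏ i ∈ range l.length, (c - i)) * ξ ^ (c - l.length) := by
  induction l generalizing c with
  | nil => intro x hx; exact ⟨x, le_rfl, by simp, by simp [iterDiff]⟩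
  | cons r l ih =>
    intro x hx
    have hr : 0 < r := hl r (by simp)
    have hl' : ∀ s ∈ l, 0 < s := fun s hs => hl s (by simp [hs])
    obtain ⟨y, hy, hy2⟩ := exists_hasDerivAt_eq_slope (iterDiff l (fun x => x ^ c))
      (fun x => c * iterDiff l (fun x => x ^ (c - 1)) x) (a := x) (b := x + r) (by linarith)
      (fun z hz => (hasDerivAt_iterDiff_rpow l hl' c z
        (lt_of_lt_of_le hx hz.1)).continuousAt.continuousWithinAt)
      (fun z hz => hasDerivAt_iterDiff_rpow l hl' c z (hx.trans hz.1))
    obtain ⟨ξ, h1, h2, h3⟩ := ih hl' (c - 1) y (hx.trans hy.1)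
    refine ⟨ξ, hy.1.le.trans h1, ?_, ?_⟩
    · simp only [List.sum_cons]; linarith [hy.2]
    · have e : iterDiff (r :: l) (fun x => x ^ c) x =
          r * (c * iterDiff l (fun x => x ^ (c - 1)) y) := by
        rw [hy2, add_sub_cancel_left]; simp only [iterDiff]; field_simp
      rw [e, h3, List.prod_cons, List.length_cons, prod_range_succ']
      push_cast
      have e1 : ∀ i : ℕ, c - ((i : ℝ) + 1) = c - 1 - i := fun i => by ring
      simp_rw [e1]
      ring_nf

lemma sum_inv_le_one_add_log (L : ℕ) : ∑ r ∈ range L, (1 : ℝ) / (r + 1) ≤ 1 + Real.log L := by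
  have := harmonic_le_one_add_log L
  simpa [harmonic] using this

/-- A Weyl-type bound for sums with phase `c x ^ γ + b x ^ 2`, obtained by differencing twice;
the bound does not depend on `b`. -/
lemma norm_sum_expi_rpow_add_sq_pos {γ c b : ℝ} (hγ0 : 0 < γ) (hγ1 : γ < 1) (hc : 0 < c) (A L : ℕ)
    (hsmall : c * (γ * (1 - γ) * (2 - γ)) * L ^ 2 * ((A : ℝ) + 1) ^ (γ - 3) ≤ 1 / 2) :
    ‖∑ i ∈ range L, expi (c * ((A + 1 + i : ℕ) : ℝ) ^ γ + b * ((A + 1 + i : ℕ) : ℝ) ^ 2)‖ ^ 4 ≤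
      10 * (L : ℝ) ^ 3 + 16 * L * ((1 + Real.log L) ^ 2 /
        (c * (γ * (1 - γ) * (2 - γ)) * ((A : ℝ) + 1 + L) ^ (γ - 3))) := by
  set κ := γ * (1 - γ) * (2 - γ) with hκ
  have hκ0 : 0 < κ := mul_pos (mul_pos hγ0 (by linarith)) (by linarith)
  set P := c * κ * ((A : ℝ) + 1 + L) ^ (γ - 3) with hP
  have hP0 : 0 < P := by positivity
  set f : ℕ → ℝ := fun i => c * ((A + 1 + i : ℕ) : ℝ) ^ γ + b * ((A + 1 + i : ℕ) : ℝ) ^ 2 with hf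
  have inner : ∀ r ∈ range L, ∀ s ∈ range (L - (r + 1)),
      ‖∑ i ∈ range (L - (r + 1) - (s + 1)), expi ((f (i + (s + 1) + (r + 1)) - f (i + (s + 1)))
        - (f (i + (r + 1)) - f i))‖ ≤ 1 / P * (1 / (r + 1)) * (1 / (s + 1)) := by
    intro r hr s hs
    rw [mem_range] at hr hs
    set g : ℕ → ℝ := fun i => (f (i + (s + 1) + (r + 1)) - f (i + (s + 1)))
        - (f (i + (r + 1)) - f i) with hg
    have hT : ∀ i, g (i + 1) - g i =
        c * iterDiff [1, (s : ℝ) + 1, (r : ℝ) + 1] (fun x => x ^ γ) ((A + 1 + i : ℕ) : ℝ) := by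
      intro i
      simp only [hg, hf, iterDiff]
      push_cast
      ring_nf
    have hT2 : ∀ i, (g (i + 2) - g (i + 1)) - (g (i + 1) - g i) =
        c * iterDiff [1, 1, (s : ℝ) + 1, (r : ℝ) + 1] (fun x => x ^ γ) ((A + 1 + i : ℕ) : ℝ) := by
      intro i
      have h1 := hT (i + 1)
      rw [add_assoc i 1 1, one_add_one_eq_two] at h1
      rw [h1, hT i]
      conv_rhs => rw [iterDiff]
      rw [← mul_sub, show ((A + 1 + (i + 1) : ℕ) : ℝ) = ((A + 1 + i : ℕ) : ℝ) + 1 by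
        push_cast; ring]
    have hT3 : ∀ i, i + (r + 1) + (s + 1) < L →
        P * (r + 1) * (s + 1) ≤ g (i + 1) - g i ∧ g (i + 1) - g i ≤ 1 / 2 := by
      intro i hi
      obtain ⟨ξ, h1, h2, h3⟩ := exists_iterDiff_rpow_eq [1, (s : ℝ) + 1, (r : ℝ) + 1]
        (by intro x hx; simp at hx; rcases hx with rfl | rfl | rfl <;> positivity)
        γ ((A + 1 + i : ℕ) : ℝ) (by positivity)
      rw [hT, h3]
      have e : c * (List.prod [1, (s : ℝ) + 1, (r : ℝ) + 1] *
          (∏ j ∈ range (List.length [1, (s : ℝ) + 1, (r : ℝ) + 1]), (γ - j)) *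
          ξ ^ (γ - (List.length [1, (s : ℝ) + 1, (r : ℝ) + 1] : ℕ))) =
          c * κ * ξ ^ (γ - 3) * (r + 1) * (s + 1) := by
        simp [prod_range_succ, hκ]
        ring
      rw [e]
      simp only [List.sum_cons, List.sum_nil] at h2
      push_cast at h1 h2
      have hi' : (i : ℝ) + (r + 1) + (s + 1) + 1 ≤ L := by exact_mod_cast hi
      have hA : (0 : ℝ) ≤ A := by positivity
      have hi0 : (0 : ℝ) ≤ i := by positivity
      have hξ0 : (A : ℝ) + 1 ≤ ξ := by linarith
      have hξ1 : ξ ≤ (A : ℝ) + 1 + L := by linarith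
      constructor
      · rw [hP]
        gcongr c * κ * ?_ * _ * _
        exact Real.rpow_le_rpow_of_nonpos (by linarith) hξ1 (by linarith)
      · refine le_trans ?_ hsmall
        have h5 : ξ ^ (γ - 3) ≤ ((A : ℝ) + 1) ^ (γ - 3) :=
          Real.rpow_le_rpow_of_nonpos (by linarith) hξ0 (by linarith)
        calc c * κ * ξ ^ (γ - 3) * (r + 1) * (s + 1)
            ≤ c * κ * ((A : ℝ) + 1) ^ (γ - 3) * L * L := by
              gcongr
              · linarith
              · linarith
          _ = _ := by ring
    have := kusmin_landau g (P * (r + 1) * (s + 1)) (L - (r + 1) - (s + 1)) (by positivity)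
      (fun m hm => (hT3 m (by omega)).1) (fun m hm => (hT3 m (by omega)).2) ?_
    · refine this.trans (le_of_eq ?_)
      field_simp
    · intro m hm
      have h0 := hT2 m
      obtain ⟨ξ, h1, h2, h3⟩ := exists_iterDiff_rpow_eq [1, 1, (s : ℝ) + 1, (r : ℝ) + 1]
        (by intro x hx; simp at hx; rcases hx with rfl | rfl | rfl <;> positivity)
        γ ((A + 1 + m : ℕ) : ℝ) (by positivity)
      have hξ0 : 0 < ξ := lt_of_lt_of_le (by positivity) h1
      rw [h3] at h0
      have e : c * (List.prod [1, 1, (s : ℝ) + 1, (r : ℝ) + 1] *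
          (∏ j ∈ range (List.length [1, 1, (s : ℝ) + 1, (r : ℝ) + 1]), (γ - j)) *
          ξ ^ (γ - (List.length [1, 1, (s : ℝ) + 1, (r : ℝ) + 1] : ℕ))) =
          - (c * κ * (3 - γ) * ξ ^ (γ - 4) * (r + 1) * (s + 1)) := by
        simp [prod_range_succ, hκ]
        ring
      rw [e] at h0
      have : 0 ≤ c * κ * (3 - γ) * ξ ^ (γ - 4) * (r + 1) * (s + 1) := by
        have : 0 ≤ 3 - γ := by linarith
        positivity
      linarith
  have hH := sum_inv_le_one_add_log L
  have hH0 : 0 ≤ ∑ r ∈ range L, (1 : ℝ) / (r + 1) := sum_nonneg fun _ _ => by positivity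
  set H := ∑ r ∈ range L, (1 : ℝ) / (r + 1) with hHdef
  set T : ℕ → ℝ := fun r => ‖∑ i ∈ range (L - (r + 1)), expi (f (i + (r + 1)) - f i)‖ with hTdef
  have hTb : ∀ r ∈ range L, T r ^ 2 ≤ L + 2 * (1 / P * (1 / (r + 1)) * H) := by
    intro r hr
    have h1 := weyl_differencing (fun i => f (i + (r + 1)) - f i) (L - (r + 1))
    refine h1.trans ?_
    have h2 : ((L - (r + 1) : ℕ) : ℝ) ≤ L := by exact_mod_cast Nat.sub_le _ _
    have h3 : ∑ s ∈ range (L - (r + 1)), ‖∑ i ∈ range (L - (r + 1) - (s + 1)),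
        expi ((f (i + (s + 1) + (r + 1)) - f (i + (s + 1))) - (f (i + (r + 1)) - f i))‖ ≤
        1 / P * (1 / (r + 1)) * H := by
      refine (sum_le_sum (inner r hr)).trans ?_
      rw [← mul_sum]
      gcongr
      exact sum_le_sum_of_subset_of_nonneg (range_subset_range.mpr (Nat.sub_le _ _))
        fun _ _ _ => by positivity
    linarith
  have hsum : (∑ r ∈ range L, T r) ^ 2 ≤ L * (L * L + 2 * (1 / P * H * H)) := by
    have h1 := sq_sum_le_card_mul_sum_sq (s := range L) (f := T)
    rw [card_range] at h1
    refine h1.trans ?_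
    gcongr
    refine (sum_le_sum hTb).trans (le_of_eq ?_)
    rw [sum_add_distrib, sum_const, card_range, nsmul_eq_mul, ← mul_sum, ← sum_mul, ← mul_sum]
  have hmain := weyl_differencing f L
  have h4 : ‖∑ i ∈ range L, expi (f i)‖ ^ 4 ≤ (L + 2 * ∑ r ∈ range L, T r) ^ 2 := by
    rw [show (4 : ℕ) = 2 * 2 by norm_num, pow_mul]
    gcongr
  have h5 : (L + 2 * ∑ r ∈ range L, T r) ^ 2 ≤ 2 * (L : ℝ) ^ 2 + 8 * (∑ r ∈ range L, T r) ^ 2 := by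
    nlinarith [sq_nonneg ((L : ℝ) - 2 * ∑ r ∈ range L, T r)]
  have h6 : (L : ℝ) ^ 2 ≤ (L : ℝ) ^ 3 := by
    have : L ^ 2 ≤ L ^ 3 := by
      rcases L with _ | L
      · simp
      · exact Nat.pow_le_pow_right (by omega) (by omega)
    exact_mod_cast this
  have h7 : H * H ≤ (1 + Real.log L) ^ 2 := by nlinarith
  have h8 : L * (L * L + 2 * (1 / P * H * H)) ≤
      (L : ℝ) ^ 3 + 2 * L * ((1 + Real.log L) ^ 2 / P) := by
    have : 1 / P * H * H ≤ (1 + Real.log L) ^ 2 / P := by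
      rw [mul_assoc, one_div_mul_eq_div]; gcongr
    have : (L : ℝ) * (1 / P * H * H) ≤ L * ((1 + Real.log L) ^ 2 / P) := by gcongr
    linarith
  linarith

lemma norm_sum_expi_rpow_add_sq {γ c b : ℝ} (hγ0 : 0 < γ) (hγ1 : γ < 1) (hc : c ≠ 0) (A L : ℕ)
    (hsmall : |c| * (γ * (1 - γ) * (2 - γ)) * L ^ 2 * ((A : ℝ) + 1) ^ (γ - 3) ≤ 1 / 2) :
    ‖∑ i ∈ range L, expi (c * ((A + 1 + i : ℕ) : ℝ) ^ γ + b * ((A + 1 + i : ℕ) : ℝ) ^ 2)‖ ^ 4 ≤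
      10 * (L : ℝ) ^ 3 + 16 * L * ((1 + Real.log L) ^ 2 /
        (|c| * (γ * (1 - γ) * (2 - γ)) * ((A : ℝ) + 1 + L) ^ (γ - 3))) := by
  rcases lt_or_gt_of_ne hc with h | h
  · rw [abs_of_neg h] at hsmall ⊢
    have := norm_sum_expi_rpow_add_sq_pos (b := -b) hγ0 hγ1 (neg_pos.mpr h) A L hsmall
    rw [← norm_sum_expi_neg] at this
    convert this using 6
    ring
  · rw [abs_of_pos h] at hsmall ⊢
    exact norm_sum_expi_rpow_add_sq_pos hγ0 hγ1 h A L hsmall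

lemma norm_sum_expi_linear (θ c lam : ℝ) (n : ℕ) (hlam : 0 < lam)
    (h : lam ≤ |θ - round θ|) : ‖∑ i ∈ range n, expi (θ * i + c)‖ ≤ 1 / lam := by
  set t := θ - round θ with ht
  have h1 : ∀ i : ℕ, expi (θ * i + c) = expi c * expi (t * i) := by
    intro i
    rw [show θ * i + c = c + t * i + ((round θ * i : ℤ) : ℝ) by rw [ht]; push_cast; ring,
      expi_add, expi_add, expi_int, mul_one]
  simp_rw [h1]
  rw [← mul_sum, norm_mul, norm_expi, one_mul]
  have h2 := abs_sub_round θ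
  rw [← ht] at h2
  rcases le_total 0 t with h0 | h0
  · rw [abs_of_nonneg h0] at h h2
    apply kusmin_landau (fun i : ℕ => t * i) lam n hlam
    all_goals intro m hm; push_cast; linarith
  · rw [abs_of_nonpos h0] at h h2
    rw [← norm_sum_expi_neg]
    apply kusmin_landau (fun i : ℕ => -(t * i)) lam n hlam
    all_goals intro m hm; push_cast; linarith

/-- Few multiples of a real with a good rational approximation are close to integers. -/
lemma card_near_int_le {α τ : ℝ} {a : ℤ} {q : ℕ} (hq : 0 < q) (hco : Int.gcd a q = 1)
    (hα : |α - a / q| < 1 / (q : ℝ) ^ 2) (hτ : 0 ≤ τ) (T : ℕ) :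
    (#((Icc 1 T).filter fun k : ℕ => |(k : ℝ) * α - round ((k : ℝ) * α)| ≤ τ) : ℝ) ≤
      (2 * (q * τ + T / q) + 1) * (T / q + 1) := by
  have hq' : (0 : ℝ) < q := by exact_mod_cast hq
  set J : ℕ := ⌊q * τ + T / q⌋₊ with hJ
  have hJ0 : (0 : ℝ) ≤ q * τ + T / q := by positivity
  have hle : #((Icc 1 T).filter fun k : ℕ => |(k : ℝ) * α - round ((k : ℝ) * α)| ≤ τ) ≤
      #(Icc (-(J : ℤ)) J ×ˢ range (T / q + 1)) := by
    apply card_le_card_of_injOn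
      (fun k : ℕ => ((k * a - round ((k : ℝ) * α) * q : ℤ), k / q))
    · intro k hk
      rw [mem_coe, mem_filter, mem_Icc] at hk
      obtain ⟨⟨hk1, hk2⟩, hk3⟩ := hk
      rw [mem_coe, mem_product, mem_range, mem_Icc, ← abs_le]
      refine ⟨?_, Nat.lt_succ_of_le (Nat.div_le_div_right hk2)⟩
      have h1 : |((k * a - round ((k : ℝ) * α) * q : ℤ) : ℝ)| ≤ q * τ + T / q := by
        have e : ((k * a - round ((k : ℝ) * α) * q : ℤ) : ℝ) =
            q * (k * α - round ((k : ℝ) * α)) - q * (k * (α - a / q)) := by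
          push_cast
          field_simp
          ring
        rw [e]
        refine (norm_sub_le (q * (k * α - round ((k : ℝ) * α)) : ℝ) _).trans ?_
        simp only [Real.norm_eq_abs]
        rw [abs_mul, abs_mul (q : ℝ), abs_mul (k : ℝ), abs_of_pos hq', Nat.abs_cast]
        have h2 : (k : ℝ) * |α - a / q| ≤ T * (1 / (q : ℝ) ^ 2) := by
          have : (k : ℝ) ≤ T := by exact_mod_cast hk2
          gcongr
        have h3 : q * ((k : ℝ) * |α - a / q|) ≤ q * (T * (1 / (q : ℝ) ^ 2)) := by gcongr
        have h4 : q * (T * (1 / (q : ℝ) ^ 2)) = T / q := by field_simp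
        have h5 : q * |(k : ℝ) * α - round ((k : ℝ) * α)| ≤ q * τ := by gcongr
        linarith
      have h2 : ((k * a - round ((k : ℝ) * α) * q : ℤ).natAbs) ≤ J := by
        apply Nat.le_floor
        rw [Nat.cast_natAbs, Int.cast_abs]
        exact h1
      rw [Int.abs_eq_natAbs]
      exact_mod_cast h2
    · intro k _ k' _ h
      simp only [Prod.mk.injEq] at h
      obtain ⟨h1, h2⟩ := h
      have h3 : (q : ℤ) ∣ a * (k - k') :=
        ⟨round ((k : ℝ) * α) - round ((k' : ℝ) * α), by linear_combination h1⟩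
      have h4 : (q : ℤ) ∣ k - k' :=
        (Int.isCoprime_iff_gcd_eq_one.mpr hco).symm.dvd_of_dvd_mul_left h3
      have h5 : k' % q = k % q := (Nat.modEq_iff_dvd.mpr h4)
      rw [← Nat.div_add_mod k q, ← Nat.div_add_mod k' q, h2, h5]
  have hcard : #(Icc (-(J : ℤ)) J ×ˢ range (T / q + 1)) = (2 * J + 1) * (T / q + 1) := by
    rw [card_product, card_range, Int.card_Icc]
    congr 1
    omega
  rw [hcard] at hle
  have h1 : (J : ℝ) ≤ q * τ + T / q := Nat.floor_le hJ0
  have h2 : ((T / q : ℕ) : ℝ) ≤ T / q := Nat.cast_div_le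
  calc (_ : ℝ) ≤ (((2 * J + 1) * (T / q + 1) : ℕ) : ℝ) := by exact_mod_cast hle
    _ ≤ _ := by push_cast; gcongr

lemma norm_sum_expi_sq {α τ : ℝ} {a : ℤ} {q : ℕ} (hq : 0 < q) (hco : Int.gcd a q = 1)
    (hα : |α - a / q| < 1 / (q : ℝ) ^ 2) (hτ : 0 < τ) {b : ℤ} (hb : b ≠ 0) (A L : ℕ) :
    ‖∑ i ∈ range L, expi (b * α * ((A + 1 + i : ℕ) : ℝ) ^ 2)‖ ^ 2 ≤
      L + 2 * (L / τ + L * ((2 * (q * τ + 2 * |(b : ℝ)| * L / q) + 1) *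
        (2 * |(b : ℝ)| * L / q + 1))) := by
  refine (weyl_differencing _ L).trans ?_
  gcongr
  set θ : ℕ → ℝ := fun r => 2 * b * α * (r + 1) with hθ
  have h1 : ∀ r ∈ range L, ‖∑ i ∈ range (L - (r + 1)),
      expi (b * α * ((A + 1 + (i + (r + 1)) : ℕ) : ℝ) ^ 2 - b * α * ((A + 1 + i : ℕ) : ℝ) ^ 2)‖ ≤
      1 / τ + if |θ r - round (θ r)| ≤ τ then (L : ℝ) else 0 := by
    intro r hr
    split_ifs with h
    · refine (norm_sum_le _ _).trans ?_
      simp_rw [norm_expi]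
      rw [sum_const, card_range, nsmul_eq_mul, mul_one]
      have : ((L - (r + 1) : ℕ) : ℝ) ≤ L := by exact_mod_cast Nat.sub_le _ _
      have : 0 < 1 / τ := by positivity
      linarith
    · rw [add_zero]
      have := norm_sum_expi_linear (θ r) (b * α * (2 * (A + 1) * (r + 1) + (r + 1) ^ 2)) τ
        (L - (r + 1)) hτ (not_le.mp h).le
      convert this using 5 with i
      simp only [hθ]
      push_cast
      ring
  refine (sum_le_sum h1).trans ?_
  rw [sum_add_distrib, sum_const, card_range, nsmul_eq_mul, mul_one_div, ← sum_filter, sum_const,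
    nsmul_eq_mul, mul_comm _ (L : ℝ)]
  gcongr
  have h2 : #{r ∈ range L | |θ r - round (θ r)| ≤ τ} ≤
      #((Icc 1 (2 * b.natAbs * L)).filter fun k : ℕ =>
        |(k : ℝ) * α - round ((k : ℝ) * α)| ≤ τ) := by
    have hb' : 0 < b.natAbs := Int.natAbs_pos.mpr hb
    apply card_le_card_of_injOn (fun r => 2 * b.natAbs * (r + 1))
    · intro r hr
      rw [mem_coe, mem_filter, mem_range] at hr
      rw [mem_coe, mem_filter, mem_Icc]
      refine ⟨⟨by nlinarith, Nat.mul_le_mul_left _ hr.1⟩, ?_⟩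
      refine le_trans ?_ hr.2
      rcases Int.natAbs_eq b with h | h
      · have e : ((2 * b.natAbs * (r + 1) : ℕ) : ℝ) * α = θ r := by
          simp only [hθ]
          generalize b.natAbs = n at h
          rw [h]
          push_cast; ring
        rw [e]
      · have e : ((2 * b.natAbs * (r + 1) : ℕ) : ℝ) * α = -θ r := by
          simp only [hθ]
          generalize b.natAbs = n at h
          rw [h]
          push_cast; ring
        rw [e]
        refine (round_le (-θ r) (-round (θ r))).trans (le_of_eq ?_)
        rw [← abs_neg]; congr 1; push_cast; ring
    · intro r _ r' _ h
      have : 2 * b.natAbs ≠ 0 := by omega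
      simp only at h
      have := Nat.eq_of_mul_eq_mul_left (Nat.pos_of_ne_zero this) h
      omega
  have h3 := card_near_int_le hq hco hα hτ.le (2 * b.natAbs * L)
  have e : ((2 * b.natAbs * L : ℕ) : ℝ) = 2 * |(b : ℝ)| * L := by
    push_cast
    rw [Nat.cast_natAbs, Int.cast_abs]
  rw [e] at h3
  exact le_trans (by exact_mod_cast h2) h3

open ArithmeticFunction in
lemma sum_moebius_div_eq (D t l : ℕ) (ht : 1 ≤ t) (hl : l ∈ Icc 1 D) :
    ∑ d ∈ (Icc 1 D).filter (fun d => t ∣ d ∧ d ∣ l), (moebius (l / d) : ℝ) =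
      if l = t then 1 else 0 := by
  rw [mem_Icc] at hl
  by_cases htl : t ∣ l
  · obtain ⟨k, rfl⟩ := htl
    have hk : k ≠ 0 := by rintro rfl; omega
    have h1 : ∑ d ∈ (Icc 1 D).filter (fun d => t ∣ d ∧ d ∣ t * k), (moebius (t * k / d) : ℝ) =
        ∑ e ∈ k.divisors, (moebius (k / e) : ℝ) := by
      symm
      apply sum_nbij (fun e => t * e)
      · intro e he
        have he' := Nat.dvd_of_mem_divisors he
        have he0 := Nat.pos_of_mem_divisors he
        rw [mem_filter, mem_Icc]
        have hdv : t * e ∣ t * k := Nat.mul_dvd_mul_left t he'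
        exact ⟨⟨Nat.mul_pos ht he0, (Nat.le_of_dvd hl.1 hdv).trans hl.2⟩, dvd_mul_right _ _, hdv⟩
      · intro e _ e' _ h
        exact Nat.eq_of_mul_eq_mul_left ht h
      · intro d hd
        rw [mem_coe, mem_filter] at hd
        obtain ⟨_, ⟨e, rfl⟩, h2⟩ := hd
        exact ⟨e, by rw [mem_coe, Nat.mem_divisors]
                     exact ⟨Nat.dvd_of_mul_dvd_mul_left ht h2, hk⟩, rfl⟩
      · intro e he
        rw [Nat.mul_div_mul_left _ _ ht]
    rw [h1, Nat.sum_div_divisors k (fun e => (moebius e : ℝ))]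
    have h2 : ∑ e ∈ k.divisors, moebius e = if k = 1 then 1 else 0 := by
      rw [← coe_mul_zeta_apply, moebius_mul_coe_zeta, one_apply]
    have h3 : (∑ e ∈ k.divisors, (moebius e : ℝ)) = ((∑ e ∈ k.divisors, moebius e : ℤ) : ℝ) := by
      push_cast; rfl
    rw [h3, h2]
    have : t * k = t ↔ k = 1 := by
      constructor
      · intro h; exact Nat.eq_of_mul_eq_mul_left ht (by rw [h, mul_one])
      · rintro rfl; simp
    simp only [this]
    split_ifs <;> simp
  · rw [filter_false_of_mem, sum_empty, if_neg]
    · rintro rfl; exact htl dvd_rfl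
    · rintro d _ ⟨h1, h2⟩; exact htl (h1.trans h2)

lemma sum_totient_Icc (D d e : ℕ) (hd : d ∈ Icc 1 D) :
    ∑ t ∈ Icc 1 D, (if t ∣ d ∧ t ∣ e then (Nat.totient t : ℝ) else 0) = Nat.gcd d e := by
  rw [mem_Icc] at hd
  rw [← sum_filter]
  have h1 : (Icc 1 D).filter (fun t => t ∣ d ∧ t ∣ e) = (Nat.gcd d e).divisors := by
    ext t
    rw [mem_filter, mem_Icc, Nat.mem_divisors, Nat.dvd_gcd_iff]
    constructor
    · rintro ⟨_, h⟩; exact ⟨h, (Nat.gcd_pos_of_pos_left _ hd.1).ne'⟩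
    · rintro ⟨h, _⟩
      exact ⟨⟨Nat.pos_of_dvd_of_pos h.1 hd.1, (Nat.le_of_dvd hd.1 h.1).trans hd.2⟩, h⟩
  rw [h1]
  exact_mod_cast Nat.sum_totient _

/-- Lower bound for the sum occurring in Selberg's sieve. -/
lemma log_le_sum_moebius_sq_div_totient (D : ℕ) :
    Real.log (D + 1) ≤ 2 * ∑ l ∈ Icc 1 D, (ArithmeticFunction.moebius l : ℝ) ^ 2 / Nat.totient l := by
  have h0 : Real.log (D + 1) ≤ ∑ n ∈ Icc 1 D, (1 : ℝ) / n := by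
    have := log_add_one_le_harmonic D
    rw [harmonic_eq_sum_Icc] at this
    simpa using this
  have hsq : ∑ m ∈ Icc 1 D, (1 : ℝ) / (m : ℝ) ^ 2 ≤ 2 := by
    have h : ∀ n : ℕ, ∑ m ∈ Icc 1 (n + 1), (1 : ℝ) / (m : ℝ) ^ 2 ≤ 2 - 1 / (n + 1) := by
      intro n
      induction n with
      | zero => norm_num
      | succ n ih =>
        rw [sum_Icc_succ_top (by omega)]
        push_cast
        have h1 : (1 : ℝ) / (n + 1 + 1) ^ 2 ≤ 1 / ((n + 1) * (n + 1 + 1)) := by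
          gcongr
          nlinarith
        have h2 : (1 : ℝ) / ((n + 1) * (n + 1 + 1)) = 1 / (n + 1) - 1 / (n + 1 + 1) := by
          field_simp
          ring
        linarith
    rcases D with _ | D
    · simp
    · refine (h D).trans ?_
      have : (0 : ℝ) ≤ 1 / (D + 1) := by positivity
      linarith
  have h1 : ∑ n ∈ Icc 1 D, (1 : ℝ) / n ≤ ∑ p ∈ Icc 1 D ×ˢ (Icc 1 D).filter Squarefree,
      (1 : ℝ) / (p.1 : ℝ) ^ 2 * (1 / p.2) := by
    have hsub : Icc 1 D ⊆ ((Icc 1 D ×ˢ (Icc 1 D).filter Squarefree).filter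
        (fun p => p.1 ^ 2 * p.2 ∈ Icc 1 D)).image (fun p : ℕ × ℕ => p.1 ^ 2 * p.2) := by
      intro n hn
      have hn' := mem_Icc.mp hn
      obtain ⟨a, b, hab, ha⟩ := Nat.sq_mul_squarefree n
      have hb0 : 0 < b := by
        rcases Nat.eq_zero_or_pos b with rfl | h
        · simp at hab; omega
        · exact h
      have ha0 : 0 < a := by
        rcases Nat.eq_zero_or_pos a with rfl | h
        · simp at hab; omega
        · exact h
      rw [mem_image]
      refine ⟨(b, a), ?_, hab⟩
      rw [mem_filter, mem_product, mem_filter, mem_Icc, mem_Icc]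
      refine ⟨⟨⟨hb0, ?_⟩, ⟨ha0, ?_⟩, ha⟩, by simpa only [hab] using hn⟩
      · have : b ≤ b ^ 2 * a := by nlinarith
        show b ≤ D; omega
      · have : a ≤ b ^ 2 * a := Nat.le_mul_of_pos_left _ (by positivity)
        show a ≤ D; omega
    refine (sum_le_sum_of_subset_of_nonneg hsub fun _ _ _ => by positivity).trans ?_
    refine (sum_image_le_of_nonneg ?_).trans ?_
    · intro i _; positivity
    · refine (sum_le_sum_of_subset_of_nonneg (filter_subset _ _) fun _ _ _ => by positivity).trans
        (sum_le_sum fun p _ => le_of_eq ?_)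
      push_cast
      rw [one_div_mul_one_div]
  rw [sum_product] at h1
  simp_rw [← mul_sum] at h1
  rw [← sum_mul] at h1
  have h2 : ∑ l ∈ (Icc 1 D).filter Squarefree, (1 : ℝ) / l ≤
      ∑ l ∈ Icc 1 D, (ArithmeticFunction.moebius l : ℝ) ^ 2 / Nat.totient l := by
    rw [sum_filter]
    refine sum_le_sum fun l hl => ?_
    have hl0 : 0 < l := (mem_Icc.mp hl).1
    split_ifs with h
    · have : (ArithmeticFunction.moebius l : ℝ) ^ 2 = 1 := by
        exact_mod_cast ArithmeticFunction.moebius_sq_eq_one_of_squarefree h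
      rw [this]
      have h3 : 0 < Nat.totient l := Nat.totient_pos.mpr hl0
      have h4 : (Nat.totient l : ℝ) ≤ l := by exact_mod_cast Nat.totient_le l
      have : (0 : ℝ) < Nat.totient l := by exact_mod_cast h3
      gcongr
    · positivity
  have h3 : (0 : ℝ) ≤ ∑ l ∈ (Icc 1 D).filter Squarefree, (1 : ℝ) / l :=
    sum_nonneg fun _ _ => by positivity
  nlinarith

open ArithmeticFunction in
/-- Weights of Selberg's upper bound sieve of level `D`. -/
lemma exists_selberg_weights (D : ℕ) (hD : 1 ≤ D) :
    ∃ lam : ℕ → ℝ, lam 1 = 1 ∧ (∀ d ∈ Icc 1 D, |lam d| ≤ (D : ℝ) ^ 2) ∧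
      ∑ d ∈ Icc 1 D, ∑ e ∈ Icc 1 D, lam d * lam e / (Nat.lcm d e : ℝ) ≤
        2 / Real.log (D + 1) := by
  set G : ℝ := ∑ l ∈ Icc 1 D, (moebius l : ℝ) ^ 2 / Nat.totient l with hG
  have hφ : ∀ l ∈ Icc 1 D, (1 : ℝ) ≤ Nat.totient l := by
    intro l hl
    exact_mod_cast Nat.totient_pos.mpr (mem_Icc.mp hl).1
  have hG1 : 1 ≤ G := by
    have := single_le_sum (f := fun l : ℕ => (moebius l : ℝ) ^ 2 / Nat.totient l)
      (fun i _ => by positivity) (mem_Icc.mpr ⟨le_rfl, hD⟩ : 1 ∈ Icc 1 D)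
    simpa using this
  set x : ℕ → ℝ := fun l => moebius l / (Nat.totient l * G) with hx
  set v : ℕ → ℝ := fun d => ∑ l ∈ Icc 1 D, if d ∣ l then (moebius (l / d) : ℝ) * x l else 0 with hv
  have hmu : ∀ n, |(moebius n : ℝ)| ≤ 1 := fun n => by exact_mod_cast abs_moebius_le_one
  have hx1 : ∀ l ∈ Icc 1 D, |x l| ≤ 1 := by
    intro l hl
    have h1 := hφ l hl
    simp only [hx]
    rw [abs_div, abs_of_pos (by positivity : 0 < (Nat.totient l : ℝ) * G),
      div_le_one (by positivity)]
    exact (hmu l).trans (one_le_mul_of_one_le_of_one_le h1 hG1)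
  have hv1 : ∀ d, |v d| ≤ D := by
    intro d
    refine (abs_sum_le_sum_abs _ _).trans ?_
    have : ∀ l ∈ Icc 1 D, |if d ∣ l then (moebius (l / d) : ℝ) * x l else 0| ≤ 1 := by
      intro l hl
      split_ifs
      · rw [abs_mul]; exact mul_le_one₀ (hmu _) (abs_nonneg _) (hx1 l hl)
      · simp
    refine (sum_le_sum this).trans ?_
    simp
  have hinv : ∀ t ∈ Icc 1 D, ∑ d ∈ Icc 1 D, (if t ∣ d then v d else 0) = x t := by
    intro t ht
    have e1 : ∀ d ∈ Icc 1 D, (if t ∣ d then v d else 0) =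
        ∑ l ∈ Icc 1 D, if t ∣ d ∧ d ∣ l then (moebius (l / d) : ℝ) * x l else 0 := by
      intro d hd
      by_cases h : t ∣ d
      · simp [h, hv]
      · simp [h]
    rw [sum_congr rfl e1, sum_comm]
    have e2 : ∀ l ∈ Icc 1 D, ∑ d ∈ Icc 1 D,
        (if t ∣ d ∧ d ∣ l then (moebius (l / d) : ℝ) * x l else 0) =
        (if l = t then 1 else 0) * x l := by
      intro l hl
      rw [← sum_filter, ← sum_mul, sum_moebius_div_eq D t l (mem_Icc.mp ht).1 hl]
    rw [sum_congr rfl e2]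
    simp only [ite_mul, one_mul, zero_mul]
    rw [sum_ite_eq', if_pos ht]
  refine ⟨fun d => d * v d, ?_, ?_, ?_⟩
  · simp only [hv, hx, Nat.cast_one, one_mul, one_dvd, if_true, Nat.div_one]
    have : ∀ l ∈ Icc 1 D, (moebius l : ℝ) * (moebius l / (Nat.totient l * G)) =
        ((moebius l : ℝ) ^ 2 / Nat.totient l) / G := by
      intro l hl; field_simp
    rw [sum_congr rfl this, ← sum_div, ← hG, div_self (by positivity)]
  · intro d hd
    rw [abs_mul, Nat.abs_cast, pow_two]
    have : (d : ℝ) ≤ D := by exact_mod_cast (mem_Icc.mp hd).2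
    gcongr
    exact hv1 d
  · have e1 : ∀ d ∈ Icc 1 D, ∀ e ∈ Icc 1 D, (d * v d) * (e * v e) / (Nat.lcm d e : ℝ) =
        ∑ t ∈ Icc 1 D, (Nat.totient t : ℝ) *
          ((if t ∣ d then v d else 0) * (if t ∣ e then v e else 0)) := by
      intro d hd e he
      have hd0 := (mem_Icc.mp hd).1
      have he0 := (mem_Icc.mp he).1
      have h1 : (Nat.gcd d e : ℝ) * Nat.lcm d e = d * e := by exact_mod_cast Nat.gcd_mul_lcm d e
      have h2 : (0 : ℝ) < Nat.lcm d e := by exact_mod_cast Nat.lcm_pos hd0 he0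
      have h3 : (d * v d) * (e * v e) / (Nat.lcm d e : ℝ) = Nat.gcd d e * (v d * v e) := by
        rw [div_eq_iff h2.ne']; linear_combination -(v d * v e) * h1
      rw [h3, ← sum_totient_Icc D d e hd, sum_mul]
      refine sum_congr rfl fun t _ => ?_
      by_cases ha : t ∣ d <;> by_cases hb : t ∣ e <;> simp [ha, hb]
    have e2 : ∑ d ∈ Icc 1 D, ∑ e ∈ Icc 1 D, (d * v d) * (e * v e) / (Nat.lcm d e : ℝ) =
        ∑ t ∈ Icc 1 D, (Nat.totient t : ℝ) * (x t) ^ 2 := by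
      rw [sum_congr rfl fun d hd => sum_congr rfl fun e he => e1 d hd e he]
      rw [sum_congr rfl fun d _ => sum_comm, sum_comm]
      refine sum_congr rfl fun t ht => ?_
      simp_rw [← mul_sum]
      rw [← sum_mul, hinv t ht, pow_two]
    rw [e2]
    have e3 : ∀ t ∈ Icc 1 D, (Nat.totient t : ℝ) * (x t) ^ 2 =
        ((moebius t : ℝ) ^ 2 / Nat.totient t) / G ^ 2 := by
      intro t ht
      have := hφ t ht
      simp only [hx]
      field_simp
    rw [sum_congr rfl e3, ← sum_div, ← hG]
    have hlog : 0 < Real.log (D + 1) := Real.log_pos (by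
      have : (1 : ℝ) ≤ D := by exact_mod_cast hD
      linarith)
    rw [div_le_div_iff₀ (by positivity) hlog]
    have := log_le_sum_moebius_sq_div_totient D
    rw [← hG] at this
    nlinarith

/-- The Fejér kernel `(1 / H) |∑_{j < H} e(jt)|²`. -/
noncomputable def fejer (H : ℕ) (t : ℝ) : ℝ := ‖∑ j ∈ range H, expi (j * t)‖ ^ 2 / H

lemma fejer_nonneg (H : ℕ) (t : ℝ) : 0 ≤ fejer H t := by unfold fejer; positivity

lemma fejer_one (t : ℝ) : fejer 1 t = 1 := by simp [fejer, norm_expi]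

lemma fejer_lower_bound {H : ℕ} (hH : 1 ≤ H) {t : ℝ} {z : ℤ} (ht : |t - z| ≤ 1 / (6 * H)) :
    (H : ℝ) / 4 ≤ fejer H t := by
  have hH' : (0 : ℝ) < H := by exact_mod_cast hH
  have h1 : ∀ j ∈ range H, (1 : ℝ) / 2 ≤ (expi (j * t)).re := by
    intro j hj
    have hj' : (j : ℝ) ≤ H := by exact_mod_cast (mem_range.mp hj).le
    have e : expi (j * t) = expi (j * (t - z)) := by
      rw [show (j : ℝ) * t = j * (t - z) + ((j * z : ℤ) : ℝ) by push_cast; ring, expi_add,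
        expi_int, mul_one]
    rw [e, expi_eq_cos_sin]
    simp only [Complex.add_re, Complex.ofReal_re, Complex.mul_re, Complex.I_re, mul_zero,
      Complex.ofReal_im, Complex.I_im, mul_one, sub_self, add_zero]
    rw [← Real.cos_pi_div_three, ← Real.cos_abs (2 * π * _)]
    apply Real.cos_le_cos_of_nonneg_of_le_pi (abs_nonneg _) (by linarith [Real.pi_pos])
    rw [abs_mul (2 * π), abs_mul (j : ℝ), abs_of_pos (by positivity : 0 < 2 * π), Nat.abs_cast]
    calc 2 * π * (j * |t - z|) ≤ 2 * π * (H * (1 / (6 * H))) := by gcongr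
      _ = π / 3 := by field_simp; norm_num
  have h2 : (H : ℝ) / 2 ≤ ‖∑ j ∈ range H, expi (j * t)‖ := by
    refine le_trans ?_ (Complex.re_le_norm _)
    rw [Complex.re_sum]
    refine le_trans (le_of_eq ?_) (sum_le_sum h1)
    rw [sum_const, card_range, nsmul_eq_mul]; ring
  unfold fejer
  rw [le_div_iff₀ hH']
  nlinarith

lemma fejer_eq_sum (H : ℕ) (t : ℝ) :
    (fejer H t : ℂ) =
      (∑ p ∈ range H ×ˢ range H, expi (((p.1 : ℤ) - (p.2 : ℤ) : ℤ) * t)) / H := by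
  unfold fejer
  push_cast
  rw [← Complex.mul_conj', sum_product]
  congr 1
  rw [map_sum, sum_mul_sum]
  refine sum_congr rfl fun j _ => sum_congr rfl fun k _ => ?_
  rw [conj_expi, ← expi_add]
  congr 1
  ring

/-- Mean value of a product of two Fejér kernels along sequences whose nontrivial exponential
sums are bounded by `B`. -/
lemma abs_sum_fejer_mul_fejer_sub_le {H₁ H₂ : ℕ} (hH₁ : 1 ≤ H₁) (hH₂ : 1 ≤ H₂) (u v : ℕ → ℝ)
    (L : ℕ) {B : ℝ} (hB0 : 0 ≤ B)
    (hB : ∀ h₁ h₂ : ℤ, |h₁| < H₁ → |h₂| < H₂ → (h₁ ≠ 0 ∨ h₂ ≠ 0) →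
      ‖∑ i ∈ range L, expi (h₁ * u i + h₂ * v i)‖ ≤ B) :
    |∑ i ∈ range L, fejer H₁ (u i) * fejer H₂ (v i) - L| ≤ H₁ * H₂ * B := by
  have h1 : (0 : ℝ) < H₁ := by exact_mod_cast hH₁
  have h2 : (0 : ℝ) < H₂ := by exact_mod_cast hH₂
  have h1' : (H₁ : ℂ) ≠ 0 := by exact_mod_cast h1.ne'
  have h2' : (H₂ : ℂ) ≠ 0 := by exact_mod_cast h2.ne'
  rw [← Real.norm_eq_abs, ← Complex.norm_real]
  push_cast
  have e0 : ∀ H : ℕ, ∑ p ∈ range H ×ˢ range H, (if p.1 = p.2 then (1 : ℂ) else 0) = H := by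
    intro H
    rw [sum_product, sum_congr rfl fun j hj => by rw [sum_ite_eq, if_pos hj]]
    simp
  have e1 : ∑ i ∈ range L, (fejer H₁ (u i) : ℂ) * fejer H₂ (v i) - L =
      (∑ p ∈ range H₁ ×ˢ range H₁, ∑ r ∈ range H₂ ×ˢ range H₂,
        (∑ i ∈ range L, expi (((p.1 : ℤ) - (p.2 : ℤ) : ℤ) * u i +
            ((r.1 : ℤ) - (r.2 : ℤ) : ℤ) * v i) -
          L * ((if p.1 = p.2 then 1 else 0) * (if r.1 = r.2 then 1 else 0)))) / (H₁ * H₂) := by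
    rw [eq_div_iff (mul_ne_zero h1' h2'), sub_mul, sum_mul]
    have e2 : ∀ i ∈ range L, (fejer H₁ (u i) : ℂ) * fejer H₂ (v i) * (H₁ * H₂) =
        ∑ p ∈ range H₁ ×ˢ range H₁, ∑ r ∈ range H₂ ×ˢ range H₂,
          expi (((p.1 : ℤ) - (p.2 : ℤ) : ℤ) * u i + ((r.1 : ℤ) - (r.2 : ℤ) : ℤ) * v i) := by
      intro i _
      rw [fejer_eq_sum, fejer_eq_sum, div_mul_div_comm, div_mul_cancel₀ _ (mul_ne_zero h1' h2'),
        sum_mul_sum]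
      exact sum_congr rfl fun p _ => sum_congr rfl fun r _ => (expi_add _ _).symm
    have e3 : ∑ p ∈ range H₁ ×ˢ range H₁, ∑ r ∈ range H₂ ×ˢ range H₂,
        (L : ℂ) * ((if p.1 = p.2 then 1 else 0) * (if r.1 = r.2 then 1 else 0)) =
        L * (H₁ * H₂) := by
      rw [← e0 H₁, ← e0 H₂, sum_mul_sum, mul_sum]
      exact sum_congr rfl fun p _ => (mul_sum _ _ _).symm
    rw [sum_congr rfl e2, sum_comm, ← e3, ← sum_sub_distrib]
    refine sum_congr rfl fun p _ => ?_
    rw [sum_comm, ← sum_sub_distrib]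
  rw [e1, norm_div, norm_mul, RCLike.norm_natCast, RCLike.norm_natCast,
    div_le_iff₀ (by positivity)]
  have key : ∀ p ∈ range H₁ ×ˢ range H₁, ∀ r ∈ range H₂ ×ˢ range H₂,
      ‖∑ i ∈ range L, expi (((p.1 : ℤ) - (p.2 : ℤ) : ℤ) * u i +
            ((r.1 : ℤ) - (r.2 : ℤ) : ℤ) * v i) -
          L * ((if p.1 = p.2 then 1 else 0) * (if r.1 = r.2 then 1 else 0))‖ ≤ B := by
    rintro ⟨j, k⟩ hp ⟨j', k'⟩ hr
    simp only [mem_product, mem_range] at hp hr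
    by_cases h : j = k ∧ j' = k'
    · obtain ⟨rfl, rfl⟩ := h
      simpa [expi_zero] using hB0
    · have : ((if j = k then 1 else 0) * (if j' = k' then 1 else 0) : ℂ) = 0 := by
        rw [not_and_or] at h
        rcases h with h | h <;> simp [h]
      dsimp only
      rw [this, mul_zero, sub_zero]
      apply hB
      · rw [abs_lt]; omega
      · rw [abs_lt]; omega
      · omega
  calc _ ≤ ∑ p ∈ range H₁ ×ˢ range H₁, ∑ r ∈ range H₂ ×ˢ range H₂, B := by
        refine (norm_sum_le _ _).trans (sum_le_sum fun p hp => ?_)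
        exact (norm_sum_le _ _).trans (sum_le_sum fun r hr => key p hp r hr)
    _ = _ := by
        simp only [sum_const, card_product, card_range, nsmul_eq_mul]
        push_cast
        ring

lemma sum_Ioc_filter_dvd {M : Type*} [AddCommMonoid M] (g : ℕ → M) (U V d : ℕ) (hd : 0 < d) :
    ∑ n ∈ (Ioc U V).filter (fun n => d ∣ n), g n =
      ∑ i ∈ range (V / d - U / d), g (d * (U / d + 1 + i)) := by
  symm
  apply sum_nbij (fun i => d * (U / d + 1 + i))
  · intro i hi
    rw [mem_range] at hi
    rw [mem_filter, mem_Ioc]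
    refine ⟨⟨?_, ?_⟩, dvd_mul_right _ _⟩
    · rw [mul_comm]; exact (Nat.div_lt_iff_lt_mul hd).mp (by omega)
    · rw [mul_comm]; exact (Nat.le_div_iff_mul_le hd).mp (by omega)
  · intro i _ j _ h
    have := Nat.eq_of_mul_eq_mul_left hd h
    omega
  · intro n hn
    rw [mem_coe, mem_filter, mem_Ioc] at hn
    obtain ⟨⟨h1, h2⟩, m, rfl⟩ := hn
    have h3 : U / d < m := (Nat.div_lt_iff_lt_mul hd).mpr (by rwa [mul_comm])
    have h4 : m ≤ V / d := (Nat.le_div_iff_mul_le hd).mpr (by rwa [mul_comm])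
    exact ⟨m - (U / d + 1), by rw [mem_coe, mem_range]; omega, by
      simp only; congr 1; omega⟩
  · intro i _; rfl

/-- Selberg's upper bound sieve for primes, with error terms bounded uniformly. -/
lemma sum_primes_le_of_level (W : ℕ → ℝ) (hW : ∀ n, 0 ≤ W n) (U V D : ℕ) (hD : 1 ≤ D)
    (hDU : D ≤ U) {E : ℝ}
    (hE : ∀ d ∈ Icc 1 (D ^ 2), |∑ n ∈ (Ioc U V).filter (fun n => d ∣ n), W n -
      ((V : ℝ) - U) / d| ≤ E) (hUV : U ≤ V) :
    ∑ p ∈ (Ioc U V).filter Nat.Prime, W p ≤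
      ((V : ℝ) - U) * (2 / Real.log (D + 1)) + (D : ℝ) ^ 6 * E := by
  obtain ⟨lam, hl1, hl2, hl3⟩ := exists_selberg_weights D hD
  have hUV' : (0 : ℝ) ≤ V - U := by
    have : (U : ℝ) ≤ V := by exact_mod_cast hUV
    linarith
  set R : ℕ → ℝ := fun d => ∑ n ∈ (Ioc U V).filter (fun n => d ∣ n), W n with hR
  have h1 : ∑ p ∈ (Ioc U V).filter Nat.Prime, W p ≤
      ∑ n ∈ Ioc U V, W n * (∑ d ∈ Icc 1 D, if d ∣ n then lam d else 0) ^ 2 := by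
    have : ∀ p ∈ (Ioc U V).filter Nat.Prime, W p =
        W p * (∑ d ∈ Icc 1 D, if d ∣ p then lam d else 0) ^ 2 := by
      intro p hp
      rw [mem_filter, mem_Ioc] at hp
      have e : ∑ d ∈ Icc 1 D, (if d ∣ p then lam d else 0) = 1 := by
        rw [sum_eq_single 1]
        · simp [hl1]
        · intro d hd hd1
          rw [if_neg]
          intro hdp
          rcases (Nat.dvd_prime hp.2).mp hdp with h | h
          · exact hd1 h
          · have := (mem_Icc.mp hd).2; omega
        · intro h; exact absurd (mem_Icc.mpr ⟨le_rfl, hD⟩) h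
      rw [e]; ring
    rw [sum_congr rfl this]
    exact sum_le_sum_of_subset_of_nonneg (filter_subset _ _)
      fun n _ _ => mul_nonneg (hW n) (sq_nonneg _)
  have h2 : ∑ n ∈ Ioc U V, W n * (∑ d ∈ Icc 1 D, if d ∣ n then lam d else 0) ^ 2 =
      ∑ d ∈ Icc 1 D, ∑ e ∈ Icc 1 D, lam d * lam e * R (Nat.lcm d e) := by
    have : ∀ n ∈ Ioc U V, W n * (∑ d ∈ Icc 1 D, if d ∣ n then lam d else 0) ^ 2 =
        ∑ d ∈ Icc 1 D, ∑ e ∈ Icc 1 D, lam d * lam e * (if Nat.lcm d e ∣ n then W n else 0) := by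
      intro n _
      rw [pow_two, sum_mul_sum, mul_sum]
      refine sum_congr rfl fun d _ => ?_
      rw [mul_sum]
      refine sum_congr rfl fun e _ => ?_
      by_cases ha : d ∣ n <;> by_cases hb : e ∣ n <;> simp [ha, hb, Nat.lcm_dvd_iff]
      ring
    rw [sum_congr rfl this, sum_comm]
    refine sum_congr rfl fun d _ => ?_
    rw [sum_comm]
    refine sum_congr rfl fun e _ => ?_
    rw [← mul_sum, ← sum_filter]
  have h3 : ∀ d ∈ Icc 1 D, ∀ e ∈ Icc 1 D, lam d * lam e * R (Nat.lcm d e) ≤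
      ((V : ℝ) - U) * (lam d * lam e / (Nat.lcm d e : ℝ)) + (D : ℝ) ^ 4 * E := by
    intro d hd e he
    have hd' := mem_Icc.mp hd
    have he' := mem_Icc.mp he
    have hm : Nat.lcm d e ∈ Icc 1 (D ^ 2) := by
      rw [mem_Icc]
      refine ⟨Nat.lcm_pos hd'.1 he'.1, ?_⟩
      calc Nat.lcm d e ≤ d * e := Nat.le_of_dvd (Nat.mul_pos hd'.1 he'.1) (Nat.lcm_dvd_mul d e)
        _ ≤ D * D := Nat.mul_le_mul hd'.2 he'.2
        _ = D ^ 2 := (pow_two D).symm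
    have h4 := hE _ hm
    have h5 : |lam d * lam e| ≤ (D : ℝ) ^ 4 := by
      rw [abs_mul]
      calc |lam d| * |lam e| ≤ (D : ℝ) ^ 2 * (D : ℝ) ^ 2 :=
            mul_le_mul (hl2 d hd) (hl2 e he) (abs_nonneg _) (by positivity)
        _ = _ := by ring
    have h6 : lam d * lam e * (R (Nat.lcm d e) - ((V : ℝ) - U) / (Nat.lcm d e : ℕ)) ≤
        (D : ℝ) ^ 4 * E := by
      refine (le_abs_self _).trans ?_
      rw [abs_mul]
      exact mul_le_mul h5 h4 (abs_nonneg _) (by positivity)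
    have : ((V : ℝ) - U) * (lam d * lam e / (Nat.lcm d e : ℝ)) =
      lam d * lam e * (((V : ℝ) - U) / (Nat.lcm d e : ℕ)) := by ring
    rw [this]
    linarith
  rw [h2] at h1
  refine h1.trans ((sum_le_sum fun d hd => sum_le_sum fun e he => h3 d hd e he).trans ?_)
  simp_rw [sum_add_distrib, ← mul_sum]
  simp only [sum_const, Nat.card_Icc, nsmul_eq_mul, Nat.add_sub_cancel]
  have : (D : ℝ) ^ 4 * (D * (D * E)) = (D : ℝ) ^ 6 * E := by ring
  rw [this]
  gcongr

lemma norm_sum_expi_block_of_ne_zero {γ : ℝ} (hγ1 : 13 / 14 < γ) (hγ2 : γ < 1) :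
    ∃ C > 0, ∃ N₀ ≥ (1 : ℝ), ∀ N ≥ N₀, ∀ (U L d : ℕ) (h b : ℝ), 1 ≤ d → (d : ℝ) ≤ N ^ (0.01 : ℝ) →
      N ^ (0.925 : ℝ) ≤ U → (U : ℝ) ≤ N → (L : ℝ) ≤ 3 * N ^ (0.9 : ℝ) → 1 ≤ |h| →
      |h| ≤ (U : ℝ) ^ (1 - γ) →
      ‖∑ i ∈ range L, expi (h * (d : ℝ) ^ γ * ((U / d + 1 + i : ℕ) : ℝ) ^ γ +
        b * ((U / d + 1 + i : ℕ) : ℝ) ^ 2)‖ ≤ C * N ^ (3 / 4 : ℝ) := by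
  set κ := γ * (1 - γ) * (2 - γ) with hκ
  have hκ0 : 0 < κ := mul_pos (mul_pos (by linarith) (by linarith)) (by linarith)
  have hκ2 : κ ≤ 2 := by
    have : γ * (1 - γ) ≤ 1 := by nlinarith
    nlinarith [mul_pos (by linarith : 0 < γ) (by linarith : 0 < 1 - γ)]
  set C₁ : ℝ := 270 + 48 * (10201 * (5 : ℝ) ^ (29 / 14 : ℝ) / κ) with hC₁
  have hC₁1 : 1 ≤ C₁ := by
    have : 0 ≤ 48 * (10201 * (5 : ℝ) ^ (29 / 14 : ℝ) / κ) := by positivity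
    linarith
  refine ⟨C₁, by linarith, (36 : ℝ) ^ (50 : ℝ), Real.one_le_rpow (by norm_num) (by norm_num), ?_⟩
  intro N hN U L d h b hd hdN hUN hUN' hLN hh1 hhU
  have hN1 : (1 : ℝ) ≤ N := le_trans (Real.one_le_rpow (by norm_num) (by norm_num)) hN
  have hN0 : 0 < N := by linarith
  have hN36 : 36 ≤ N ^ (0.02 : ℝ) := by
    calc (36 : ℝ) = ((36 : ℝ) ^ (50 : ℝ)) ^ (0.02 : ℝ) := by
          rw [← Real.rpow_mul (by norm_num)]; norm_num
      _ ≤ _ := Real.rpow_le_rpow (by positivity) hN (by norm_num)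
  have hd0 : (0 : ℝ) < d := by exact_mod_cast hd
  have hd1 : (1 : ℝ) ≤ d := by exact_mod_cast hd
  have hU0 : (0 : ℝ) < U := lt_of_lt_of_le (by positivity) hUN
  have hL0 : (0 : ℝ) ≤ L := Nat.cast_nonneg _
  have hc1 : 1 ≤ |h * (d : ℝ) ^ γ| := by
    rw [abs_mul, abs_of_pos (by positivity : (0 : ℝ) < (d : ℝ) ^ γ)]
    exact one_le_mul_of_one_le_of_one_le hh1 (Real.one_le_rpow hd1 (by linarith))
  have hA : (U : ℝ) / d ≤ ((U / d : ℕ) : ℝ) + 1 := (Nat.lt_floor_add_one ((U : ℝ) / d)).le.trans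
    (by rw [Nat.floor_div_eq_div])
  have hA' : ((U / d : ℕ) : ℝ) ≤ N := by
    refine le_trans ?_ hUN'
    exact_mod_cast Nat.div_le_self U d
  have hUd : 0 < (U : ℝ) / d := by positivity
  have hsmall : |h * (d : ℝ) ^ γ| * κ * (L : ℝ) ^ 2 * (((U / d : ℕ) : ℝ) + 1) ^ (γ - 3) ≤ 1 / 2 := by
    have e1 : (((U / d : ℕ) : ℝ) + 1) ^ (γ - 3) ≤ ((U : ℝ) / d) ^ (γ - 3) :=
      Real.rpow_le_rpow_of_nonpos hUd hA (by linarith)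
    rw [abs_mul, abs_of_pos (by positivity : (0 : ℝ) < (d : ℝ) ^ γ)]
    calc |h| * (d : ℝ) ^ γ * κ * (L : ℝ) ^ 2 * (((U / d : ℕ) : ℝ) + 1) ^ (γ - 3)
        ≤ (U : ℝ) ^ (1 - γ) * (d : ℝ) ^ γ * 2 * (3 * N ^ (0.9 : ℝ)) ^ 2 *
            ((U : ℝ) / d) ^ (γ - 3) := by gcongr
      _ = 18 * (N ^ (0.9 : ℝ)) ^ 2 * ((d : ℝ) ^ γ * (d : ℝ) ^ (3 - γ)) *
            ((U : ℝ) ^ (1 - γ) * (U : ℝ) ^ (γ - 3)) := by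
          rw [Real.div_rpow hU0.le hd0.le, show γ - 3 = -(3 - γ) by ring,
            Real.rpow_neg hd0.le]
          field_simp
          norm_num
      _ = 18 * (N ^ (0.9 : ℝ)) ^ 2 * (d : ℝ) ^ (3 : ℝ) * (U : ℝ) ^ (-2 : ℝ) := by
          rw [← Real.rpow_add hd0, ← Real.rpow_add hU0]
          congr 2 <;> ring_nf
      _ ≤ 18 * (N ^ (0.9 : ℝ)) ^ 2 * (N ^ (0.01 : ℝ)) ^ (3 : ℝ) *
            (N ^ (0.925 : ℝ)) ^ (-2 : ℝ) := by
          have := Real.rpow_le_rpow_of_nonpos (by positivity) hUN (by norm_num : (-2 : ℝ) ≤ 0)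
          gcongr
      _ = 18 * (N ^ (0.02 : ℝ))⁻¹ := by
          rw [← Real.rpow_natCast, ← Real.rpow_mul hN0.le, ← Real.rpow_mul hN0.le,
            ← Real.rpow_mul hN0.le, mul_assoc, mul_assoc, ← Real.rpow_add hN0,
            ← Real.rpow_add hN0, ← Real.rpow_neg hN0.le]
          norm_num
      _ ≤ 18 * (36 : ℝ)⁻¹ := by gcongr
      _ = 1 / 2 := by norm_num
  have key := norm_sum_expi_rpow_add_sq (γ := γ) (b := b) (by linarith) hγ2
    (abs_pos.mp (by linarith)) (U / d) L hsmall
  have hN09 : N ^ (0.9 : ℝ) ≤ N := by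
    conv_rhs => rw [← Real.rpow_one N]
    exact Real.rpow_le_rpow_of_exponent_le hN1 (by norm_num)
  have hsum : ((U / d : ℕ) : ℝ) + 1 + L ≤ 5 * N := by linarith
  have hden : (5 * N) ^ (-(29 / 14) : ℝ) ≤ (((U / d : ℕ) : ℝ) + 1 + L) ^ (γ - 3) := by
    calc (5 * N) ^ (-(29 / 14) : ℝ) ≤ (5 * N) ^ (γ - 3) :=
          Real.rpow_le_rpow_of_exponent_le (by linarith) (by linarith)
      _ ≤ _ := Real.rpow_le_rpow_of_nonpos (by positivity) hsum (by linarith)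
  have hlog0 : 0 ≤ Real.log L := Real.log_natCast_nonneg L
  have hlog : 1 + Real.log L ≤ 101 * N ^ (0.01 : ℝ) := by
    have h1 : (1 : ℝ) ≤ N ^ (0.01 : ℝ) := Real.one_le_rpow hN1 (by norm_num)
    have h2 : Real.log L ≤ Real.log N := by
      rcases Nat.eq_zero_or_pos L with rfl | hL
      · simpa using Real.log_nonneg hN1
      · refine Real.log_le_log (by exact_mod_cast hL) (hLN.trans ?_)
        have h3 : (36 : ℝ) ≤ N ^ (0.1 : ℝ) :=
          hN36.trans (Real.rpow_le_rpow_of_exponent_le hN1 (by norm_num))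
        calc 3 * N ^ (0.9 : ℝ) ≤ N ^ (0.1 : ℝ) * N ^ (0.9 : ℝ) := by gcongr; linarith
          _ = N := by rw [← Real.rpow_add hN0]; norm_num
    have h3 := Real.log_le_rpow_div hN0.le (by norm_num : (0 : ℝ) < 0.01)
    have h4 : N ^ (0.01 : ℝ) / 0.01 = 100 * N ^ (0.01 : ℝ) := by ring
    linarith
  have h4 : ‖∑ i ∈ range L, expi (h * (d : ℝ) ^ γ * ((U / d + 1 + i : ℕ) : ℝ) ^ γ +
      b * ((U / d + 1 + i : ℕ) : ℝ) ^ 2)‖ ^ 4 ≤ C₁ * N ^ (3 : ℝ) := by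
    refine key.trans ?_
    have t1 : 10 * (L : ℝ) ^ 3 ≤ 270 * N ^ (3 : ℝ) := by
      calc 10 * (L : ℝ) ^ 3 ≤ 10 * (3 * N) ^ 3 := by gcongr; linarith
        _ = 270 * N ^ (3 : ℝ) := by norm_cast; ring
    have t2 : (1 + Real.log L) ^ 2 / (|h * (d : ℝ) ^ γ| * κ *
        (((U / d : ℕ) : ℝ) + 1 + L) ^ (γ - 3)) ≤
        (101 * N ^ (0.01 : ℝ)) ^ 2 / (1 * κ * (5 * N) ^ (-(29 / 14) : ℝ)) := by
      gcongr
    have t3 : 16 * (L : ℝ) * ((1 + Real.log L) ^ 2 / (|h * (d : ℝ) ^ γ| * κ *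
        (((U / d : ℕ) : ℝ) + 1 + L) ^ (γ - 3))) ≤
        48 * (10201 * (5 : ℝ) ^ (29 / 14 : ℝ) / κ) * N ^ (3 : ℝ) := by
      calc _ ≤ 16 * (3 * N ^ (0.9 : ℝ)) *
            ((101 * N ^ (0.01 : ℝ)) ^ 2 / (1 * κ * (5 * N) ^ (-(29 / 14) : ℝ))) := by gcongr
        _ = 48 * (10201 * (5 : ℝ) ^ (29 / 14 : ℝ) / κ) *
            (N ^ (0.9 : ℝ) * ((N ^ (0.01 : ℝ)) ^ 2 * N ^ (29 / 14 : ℝ))) := by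
          rw [Real.rpow_neg (by positivity), Real.mul_rpow (by norm_num) hN0.le]
          field_simp
          norm_num
        _ ≤ 48 * (10201 * (5 : ℝ) ^ (29 / 14 : ℝ) / κ) * N ^ (3 : ℝ) := by
          gcongr
          rw [← Real.rpow_natCast, ← Real.rpow_mul hN0.le, ← Real.rpow_add hN0,
            ← Real.rpow_add hN0]
          exact Real.rpow_le_rpow_of_exponent_le hN1 (by norm_num)
    rw [hC₁, add_mul]
    exact add_le_add t1 t3
  refine le_of_pow_le_pow_left₀ (n := 4) (by norm_num) (by positivity) (h4.trans ?_)
  rw [mul_pow, ← Real.rpow_natCast (N ^ _), ← Real.rpow_mul hN0.le]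
  norm_num
  gcongr
  exact le_self_pow₀ hC₁1 (by norm_num)

lemma norm_sum_expi_sq_block {N α : ℝ} {a : ℤ} {q : ℕ} (hN : 1 ≤ N) (hco : Int.gcd a q = 1)
    (hα : |α - a / q| < 1 / (q : ℝ) ^ 2) (hq1 : N ^ (0.9 : ℝ) ≤ q) (hq2 : (q : ℝ) ≤ N)
    {b : ℤ} (hb : b ≠ 0) (hb' : |(b : ℝ)| ≤ N ^ (0.06 : ℝ)) (A L : ℕ)
    (hL : (L : ℝ) ≤ 3 * N ^ (0.9 : ℝ)) :
    ‖∑ i ∈ range L, expi (b * α * ((A + 1 + i : ℕ) : ℝ) ^ 2)‖ ≤ 40 * N ^ (3 / 4 : ℝ) := by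
  have hN0 : 0 < N := by linarith
  have hq0' : (0 : ℝ) < q := lt_of_lt_of_le (by positivity) hq1
  have hq0 : 0 < q := by exact_mod_cast hq0'
  have key := norm_sum_expi_sq hq0 hco hα (τ := N ^ (-(1 / 2) : ℝ)) (by positivity) hb A L
  have hbL : 2 * |(b : ℝ)| * L / q ≤ 6 * N ^ (0.06 : ℝ) := by
    rw [div_le_iff₀ hq0']
    calc 2 * |(b : ℝ)| * L ≤ 2 * N ^ (0.06 : ℝ) * (3 * N ^ (0.9 : ℝ)) := by gcongr
      _ = 6 * N ^ (0.06 : ℝ) * N ^ (0.9 : ℝ) := by ring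
      _ ≤ _ := by gcongr
  have hqτ : q * N ^ (-(1 / 2) : ℝ) ≤ N ^ (1 / 2 : ℝ) := by
    calc q * N ^ (-(1 / 2) : ℝ) ≤ N ^ (1 : ℝ) * N ^ (-(1 / 2) : ℝ) := by
          rw [Real.rpow_one]; gcongr
      _ = _ := by rw [← Real.rpow_add hN0]; norm_num
  have m : ∀ {x y : ℝ}, x ≤ y → N ^ x ≤ N ^ y := fun h => Real.rpow_le_rpow_of_exponent_le hN h
  have o : ∀ {x : ℝ}, 0 ≤ x → 1 ≤ N ^ x := fun h => Real.one_le_rpow hN h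
  have f1 : 2 * (q * N ^ (-(1 / 2) : ℝ) + 2 * |(b : ℝ)| * L / q) + 1 ≤ 15 * N ^ (1 / 2 : ℝ) := by
    have := m (by norm_num : (0.06 : ℝ) ≤ 1 / 2)
    have := o (by norm_num : (0 : ℝ) ≤ 1 / 2)
    linarith
  have f2 : 2 * |(b : ℝ)| * L / q + 1 ≤ 7 * N ^ (0.06 : ℝ) := by
    have := o (by norm_num : (0 : ℝ) ≤ 0.06)
    linarith
  have h2 : ‖∑ i ∈ range L, expi (b * α * ((A + 1 + i : ℕ) : ℝ) ^ 2)‖ ^ 2 ≤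
      1600 * N ^ (3 / 2 : ℝ) := by
    refine key.trans ?_
    calc _ ≤ 3 * N ^ (0.9 : ℝ) + 2 * (3 * N ^ (0.9 : ℝ) / N ^ (-(1 / 2) : ℝ) +
          3 * N ^ (0.9 : ℝ) * (15 * N ^ (1 / 2 : ℝ) * (7 * N ^ (0.06 : ℝ)))) := by gcongr
      _ = 3 * N ^ (0.9 : ℝ) + 6 * N ^ (1.4 : ℝ) + 630 * N ^ (1.46 : ℝ) := by
          rw [show (1.4 : ℝ) = 0.9 + 1 / 2 by norm_num,
            show (1.46 : ℝ) = 0.9 + 1 / 2 + 0.06 by norm_num, Real.rpow_add hN0, Real.rpow_add hN0,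
            Real.rpow_add hN0, Real.rpow_neg hN0.le]
          field_simp
          ring
      _ ≤ _ := by
          have := m (by norm_num : (0.9 : ℝ) ≤ 3 / 2)
          have := m (by norm_num : (1.4 : ℝ) ≤ 3 / 2)
          have := m (by norm_num : (1.46 : ℝ) ≤ 3 / 2)
          linarith [o (by norm_num : (0 : ℝ) ≤ 3 / 2)]
  refine le_of_pow_le_pow_left₀ (n := 2) (by norm_num) (by positivity) (h2.trans ?_)
  rw [mul_pow, ← Real.rpow_natCast (N ^ _), ← Real.rpow_mul hN0.le]
  norm_num

lemma natCast_div_sub_div_bounds {U V d : ℕ} (hd : 0 < d) (hUV : U ≤ V) :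
    |((V / d - U / d : ℕ) : ℝ) - ((V : ℝ) - U) / d| ≤ 1 := by
  have hd0 : (0 : ℝ) < d := by exact_mod_cast hd
  rw [Nat.cast_sub (Nat.div_le_div_right hUV), sub_div, abs_le]
  have e1 : ((V / d : ℕ) : ℝ) ≤ (V : ℝ) / d := Nat.cast_div_le
  have e2 : ((U / d : ℕ) : ℝ) ≤ (U : ℝ) / d := Nat.cast_div_le
  have e3 : (V : ℝ) / d ≤ ((V / d : ℕ) : ℝ) + 1 := (Nat.lt_floor_add_one _).le.trans
    (by rw [Nat.floor_div_eq_div])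
  have e4 : (U : ℝ) / d ≤ ((U / d : ℕ) : ℝ) + 1 := (Nat.lt_floor_add_one _).le.trans
    (by rw [Nat.floor_div_eq_div])
  constructor <;> linarith

lemma norm_sum_expi_fejer_phase {γ : ℝ} (hγ1 : 13 / 14 < γ) (hγ2 : γ < 1) :
    ∃ C > 0, ∃ N₀ ≥ (1 : ℝ), ∀ N ≥ N₀, ∀ (α β : ℝ) (a : ℤ) (q : ℕ), Int.gcd a q = 1 →
      |α - a / q| < 1 / (q : ℝ) ^ 2 → N ^ (0.9 : ℝ) ≤ q → (q : ℝ) ≤ N →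
      ∀ (U L d : ℕ) (h₁ h₂ : ℤ), 1 ≤ d → (d : ℝ) ≤ N ^ (0.01 : ℝ) →
      N ^ (0.925 : ℝ) ≤ U → (U : ℝ) ≤ N → (L : ℝ) ≤ 3 * N ^ (0.9 : ℝ) →
      |(h₁ : ℝ)| ≤ (U : ℝ) ^ (1 - γ) → |(h₂ : ℝ)| ≤ N ^ (1 / 29 : ℝ) → (h₁ ≠ 0 ∨ h₂ ≠ 0) →
      ‖∑ i ∈ range L, expi (h₁ * ((d * (U / d + 1 + i) : ℕ) : ℝ) ^ γ +
        h₂ * (α * ((d * (U / d + 1 + i) : ℕ) : ℝ) ^ 2 + β))‖ ≤ C * N ^ (3 / 4 : ℝ) := by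
  obtain ⟨C, hC, N₀, hN₀, H⟩ := norm_sum_expi_block_of_ne_zero hγ1 hγ2
  refine ⟨max C 40, lt_max_of_lt_left hC, N₀, hN₀, ?_⟩
  intro N hN α β a q hco hα hq1 hq2 U L d h₁ h₂ hd hdN hU1 hU2 hL hh1 hh2 hne
  have hN1 : 1 ≤ N := hN₀.trans hN
  have hN0 : 0 < N := by linarith
  have hd0 : (0 : ℝ) < d := by exact_mod_cast hd
  have e : ∀ i ∈ range L, expi (h₁ * ((d * (U / d + 1 + i) : ℕ) : ℝ) ^ γ +
        h₂ * (α * ((d * (U / d + 1 + i) : ℕ) : ℝ) ^ 2 + β)) =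
      expi (h₂ * β) * expi (h₁ * (d : ℝ) ^ γ * ((U / d + 1 + i : ℕ) : ℝ) ^ γ +
        (h₂ * α * (d : ℝ) ^ 2) * ((U / d + 1 + i : ℕ) : ℝ) ^ 2) := by
    intro i _
    rw [← expi_add, Nat.cast_mul, Real.mul_rpow hd0.le (Nat.cast_nonneg _)]
    congr 1
    ring
  rw [sum_congr rfl e, ← mul_sum, norm_mul, norm_expi, one_mul]
  by_cases h1 : h₁ = 0
  · have h2 : h₂ ≠ 0 := by simpa [h1] using hne
    have hb : h₂ * (d : ℤ) ^ 2 ≠ 0 := mul_ne_zero h2 (by positivity)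
    have key := norm_sum_expi_sq_block hN1 hco hα hq1 hq2 hb (by
      push_cast
      rw [abs_mul, abs_of_pos (by positivity : (0 : ℝ) < (d : ℝ) ^ 2)]
      calc |(h₂ : ℝ)| * (d : ℝ) ^ 2 ≤ N ^ (1 / 29 : ℝ) * (N ^ (0.01 : ℝ)) ^ 2 := by gcongr
        _ ≤ _ := by
          rw [← Real.rpow_natCast (N ^ _), ← Real.rpow_mul hN0.le, ← Real.rpow_add hN0]
          exact Real.rpow_le_rpow_of_exponent_le hN1 (by norm_num)) (U / d) L hL
    refine le_trans (le_of_eq ?_) (key.trans ?_)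
    · congr 1
      refine sum_congr rfl fun i _ => ?_
      rw [h1]
      push_cast
      congr 1
      ring
    · gcongr; exact le_max_right _ _
  · refine (H N hN U L d h₁ _ hd hdN hU1 hU2 hL ?_ hh1).trans ?_
    · exact_mod_cast Int.one_le_abs h1
    · gcongr; exact le_max_left _ _

/-- Upper bound of the right order of magnitude for Fejér-weighted sums over primes in short
blocks. -/
lemma sum_primes_fejer_le {γ : ℝ} (hγ1 : 13 / 14 < γ) (hγ2 : γ < 1) :
    ∃ K > 0, ∃ N₀ ≥ (1 : ℝ), ∀ N ≥ N₀, ∀ (α β : ℝ) (a : ℤ) (q : ℕ), Int.gcd a q = 1 →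
      |α - a / q| < 1 / (q : ℝ) ^ 2 → N ^ (0.9 : ℝ) ≤ q → (q : ℝ) ≤ N →
      ∀ (U V H₁ H₂ : ℕ), N ^ (0.925 : ℝ) ≤ U → (U : ℝ) ≤ N → U ≤ V →
      (V : ℝ) - U ≤ 2 * N ^ (0.9 : ℝ) → 1 ≤ H₁ → (H₁ : ℝ) ≤ (U : ℝ) ^ (1 - γ) →
      1 ≤ H₂ → (H₂ : ℝ) ≤ N ^ (1 / 29 : ℝ) →
      ∑ p ∈ (Ioc U V).filter Nat.Prime,
        fejer H₁ ((p : ℝ) ^ γ) * fejer H₂ (α * (p : ℝ) ^ 2 + β) * Real.log p ≤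
          K * N ^ (0.9 : ℝ) := by
  obtain ⟨C, hC, N₀, hN₀, H⟩ := norm_sum_expi_fejer_phase hγ1 hγ2
  refine ⟨6400 + 500 * (C + 1), by positivity, max N₀ 3, hN₀.trans (le_max_left _ _), ?_⟩
  intro N hN' α β a q hco hα hq1 hq2 U V H₁ H₂ hU1 hU2 hUV hVU hH1 hH1' hH2 hH2'
  have hN : N₀ ≤ N := (le_max_left _ _).trans hN'
  have hN3 : 3 ≤ N := (le_max_right _ _).trans hN'
  have hN1 : 1 ≤ N := hN₀.trans hN
  have hN0 : 0 < N := by linarith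
  have hlog0 : 0 < Real.log N := Real.log_pos (by linarith)
  have m : ∀ {x y : ℝ}, x ≤ y → N ^ x ≤ N ^ y := fun h => Real.rpow_le_rpow_of_exponent_le hN1 h
  have o : ∀ {x : ℝ}, 0 ≤ x → 1 ≤ N ^ x := fun h => Real.one_le_rpow hN1 h
  set D := ⌊N ^ (0.005 : ℝ)⌋₊ with hD
  have hD1 : 1 ≤ D := Nat.le_floor (by simpa using o (by norm_num))
  have hDN : (D : ℝ) ≤ N ^ (0.005 : ℝ) := Nat.floor_le (by positivity)
  have hDU : D ≤ U := by
    have : (D : ℝ) ≤ U := hDN.trans ((m (by norm_num)).trans hU1)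
    exact_mod_cast this
  have hH1N : (H₁ : ℝ) ≤ N ^ (1 / 14 : ℝ) := by
    refine hH1'.trans ((Real.rpow_le_rpow (Nat.cast_nonneg _) hU2 (by linarith)).trans
      (m (by linarith)))
  set E : ℝ := H₁ * H₂ * (C * N ^ (3 / 4 : ℝ)) + 1 with hE
  have hEN : E ≤ (C + 1) * N ^ (0.86 : ℝ) := by
    have h1 : (H₁ : ℝ) * H₂ * (C * N ^ (3 / 4 : ℝ)) ≤ C * N ^ (0.86 : ℝ) := by
      calc _ ≤ N ^ (1 / 14 : ℝ) * N ^ (1 / 29 : ℝ) * (C * N ^ (3 / 4 : ℝ)) := by gcongr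
        _ = C * (N ^ (1 / 14 : ℝ) * N ^ (1 / 29 : ℝ) * N ^ (3 / 4 : ℝ)) := by ring
        _ ≤ _ := by
          rw [← Real.rpow_add hN0, ← Real.rpow_add hN0]
          exact mul_le_mul_of_nonneg_left (m (by norm_num)) hC.le
    have := o (by norm_num : (0 : ℝ) ≤ 0.86)
    rw [hE]; linarith
  have hE0 : 0 ≤ E := by positivity
  have level : ∀ d ∈ Icc 1 (D ^ 2), |∑ n ∈ (Ioc U V).filter (fun n => d ∣ n),
      fejer H₁ ((n : ℝ) ^ γ) * fejer H₂ (α * (n : ℝ) ^ 2 + β) - ((V : ℝ) - U) / d| ≤ E := by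
    intro d hd
    rw [mem_Icc] at hd
    have hdN : (d : ℝ) ≤ N ^ (0.01 : ℝ) := by
      calc (d : ℝ) ≤ (D : ℝ) ^ 2 := by exact_mod_cast hd.2
        _ ≤ (N ^ (0.005 : ℝ)) ^ 2 := by gcongr
        _ = _ := by rw [← Real.rpow_natCast, ← Real.rpow_mul hN0.le]; norm_num
    have hd1 : (1 : ℝ) ≤ d := by exact_mod_cast hd.1
    have hb := natCast_div_sub_div_bounds (d := d) hd.1 hUV
    have hL : ((V / d - U / d : ℕ) : ℝ) ≤ 3 * N ^ (0.9 : ℝ) := by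
      have h1 : ((V : ℝ) - U) / d ≤ V - U := div_le_self (by
        have : (U : ℝ) ≤ V := by exact_mod_cast hUV
        linarith) hd1
      have := (abs_le.mp hb).2
      have := o (by norm_num : (0 : ℝ) ≤ 0.9)
      linarith
    rw [sum_Ioc_filter_dvd _ U V d hd.1]
    have hf := abs_sum_fejer_mul_fejer_sub_le hH1 hH2
      (fun i => ((d * (U / d + 1 + i) : ℕ) : ℝ) ^ γ)
      (fun i => α * ((d * (U / d + 1 + i) : ℕ) : ℝ) ^ 2 + β) (V / d - U / d)
      (B := C * N ^ (3 / 4 : ℝ)) (by positivity) (by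
        intro h₁ h₂ hh1 hh2 hne
        refine H N hN α β a q hco hα hq1 hq2 U _ d h₁ h₂ hd.1 hdN hU1 hU2 hL ?_ ?_ hne
        · refine le_trans ?_ hH1'
          exact_mod_cast hh1.le
        · refine le_trans ?_ hH2'
          exact_mod_cast hh2.le)
    refine (abs_sub_le _ _ _).trans (add_le_add hf hb)
  have key := sum_primes_le_of_level
    (fun n => fejer H₁ ((n : ℝ) ^ γ) * fejer H₂ (α * (n : ℝ) ^ 2 + β))
    (fun n => mul_nonneg (fejer_nonneg _ _) (fejer_nonneg _ _)) U V D hD1 hDU level hUV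
  have hlogD : 0.005 * Real.log N ≤ Real.log (D + 1) := by
    rw [← Real.log_rpow hN0]
    exact Real.log_le_log (by positivity) (Nat.lt_floor_add_one _).le
  have hlogp : ∀ p ∈ (Ioc U V).filter Nat.Prime, Real.log p ≤ 3 * Real.log N := by
    intro p hp
    rw [mem_filter, mem_Ioc] at hp
    have hp0 : (0 : ℝ) < p := by exact_mod_cast hp.2.pos
    have : (p : ℝ) ≤ N ^ 3 := by
      have h1 : (p : ℝ) ≤ V := by exact_mod_cast hp.1.2
      have h2 : N ^ (0.9 : ℝ) ≤ N := by simpa using m (by norm_num : (0.9 : ℝ) ≤ 1)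
      calc (p : ℝ) ≤ 3 * N := by linarith
        _ ≤ N ^ 2 * N := by gcongr; nlinarith
        _ = N ^ 3 := by ring
    calc Real.log p ≤ Real.log (N ^ 3) := Real.log_le_log hp0 this
      _ = _ := by rw [Real.log_pow]; norm_num
  have hlogN : Real.log N ≤ 100 * N ^ (0.01 : ℝ) := by
    have h3 := Real.log_le_rpow_div hN0.le (by norm_num : (0 : ℝ) < 0.01)
    have h4 : N ^ (0.01 : ℝ) / 0.01 = 100 * N ^ (0.01 : ℝ) := by ring
    linarith
  have hlogD0 : 0 ≤ 2 / Real.log ((D : ℝ) + 1) :=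
    div_nonneg (by norm_num) ((by positivity : 0 ≤ 0.005 * Real.log N).trans hlogD)
  calc ∑ p ∈ (Ioc U V).filter Nat.Prime,
        fejer H₁ ((p : ℝ) ^ γ) * fejer H₂ (α * (p : ℝ) ^ 2 + β) * Real.log p
      ≤ ∑ p ∈ (Ioc U V).filter Nat.Prime,
        fejer H₁ ((p : ℝ) ^ γ) * fejer H₂ (α * (p : ℝ) ^ 2 + β) * (3 * Real.log N) :=
        sum_le_sum fun p hp => mul_le_mul_of_nonneg_left (hlogp p hp)
          (mul_nonneg (fejer_nonneg _ _) (fejer_nonneg _ _))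
    _ ≤ (2 * N ^ (0.9 : ℝ) * (2 / (0.005 * Real.log N)) +
          (N ^ (0.005 : ℝ)) ^ 6 * ((C + 1) * N ^ (0.86 : ℝ))) * (3 * Real.log N) := by
        rw [← sum_mul]
        gcongr
        refine key.trans ?_
        gcongr
    _ = 2400 * N ^ (0.9 : ℝ) +
          3 * Real.log N * ((N ^ (0.005 : ℝ)) ^ 6 * ((C + 1) * N ^ (0.86 : ℝ))) := by
        field_simp
        ring
    _ ≤ 2400 * N ^ (0.9 : ℝ) + 3 * (100 * N ^ (0.01 : ℝ)) *
          ((N ^ (0.005 : ℝ)) ^ 6 * ((C + 1) * N ^ (0.86 : ℝ))) := by gcongr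
    _ = 2400 * N ^ (0.9 : ℝ) + 300 * (C + 1) * N ^ (0.9 : ℝ) := by
        rw [show (0.9 : ℝ) = 0.01 + 0.005 * (6 : ℕ) + 0.86 by norm_num, Real.rpow_add hN0,
          Real.rpow_add hN0, Real.rpow_mul hN0.le, Real.rpow_natCast]
        ring
    _ ≤ _ := by
        have := o (by norm_num : (0 : ℝ) ≤ 0.9)
        nlinarith

lemma abs_psi_sub_psi_le_one (x y : ℝ) : |psi x - psi y| ≤ 1 := by
  unfold psi
  have := Int.fract_nonneg x
  have := Int.fract_nonneg y
  have := (Int.fract_lt_one x).le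
  have := (Int.fract_lt_one y).le
  rw [abs_le]
  constructor <;> linarith

lemma abs_psi_neg_sub_psi_neg_le {H : ℕ} (hH : 1 ≤ H) {x y : ℝ} (hxy : x ≤ y)
    (h : y - x ≤ 1 / (6 * H)) : |psi (-y) - psi (-x)| ≤ 4 / H * fejer H x + (y - x) := by
  have hH' : (0 : ℝ) < H := by exact_mod_cast hH
  have hle : ⌊-y⌋ ≤ ⌊-x⌋ := Int.floor_mono (neg_le_neg hxy)
  rcases hle.eq_or_lt with heq | hlt
  · have : psi (-y) - psi (-x) = -(y - x) := by
      unfold psi Int.fract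
      rw [heq]; ring
    rw [this, abs_neg, abs_of_nonneg (by linarith)]
    have := fejer_nonneg H x
    linarith [(by positivity : 0 ≤ 4 / (H : ℝ) * fejer H x)]
  · have h1 : ((-⌊-x⌋ : ℤ) : ℝ) < y := by
      have h2 := Int.lt_floor_add_one (-y)
      have h3 : ((⌊-y⌋ + 1 : ℤ) : ℝ) ≤ (⌊-x⌋ : ℤ) := by exact_mod_cast hlt
      push_cast at h3 ⊢
      linarith
    have h2 : x ≤ ((-⌊-x⌋ : ℤ) : ℝ) := by
      have := Int.floor_le (-x)
      push_cast
      linarith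
    have hf := fejer_lower_bound hH (t := x) (z := -⌊-x⌋) (by
      rw [abs_le]; constructor <;> linarith)
    have : 1 ≤ 4 / H * fejer H x := by
      calc (1 : ℝ) = 4 / H * (H / 4) := by field_simp
        _ ≤ _ := by gcongr
    linarith [abs_psi_sub_psi_le_one (-y) (-x)]

lemma Fdelta_nonneg (Δ θ : ℝ) : 0 ≤ Fdelta Δ θ := by unfold Fdelta; split_ifs <;> norm_num

lemma Fdelta_le_one (Δ θ : ℝ) : Fdelta Δ θ ≤ 1 := by unfold Fdelta; split_ifs <;> norm_num

lemma Fdelta_le_fejer {H : ℕ} (hH : 1 ≤ H) {Δ : ℝ} (hΔ : Δ ≤ 1 / (6 * H)) (θ : ℝ) :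
    Fdelta Δ θ ≤ 4 / H * fejer H θ := by
  have hH' : (0 : ℝ) < H := by exact_mod_cast hH
  have h0 := fejer_nonneg H θ
  unfold Fdelta
  split_ifs with h
  · have hf := fejer_lower_bound hH (t := θ) (z := ⌊θ + 1 / 2⌋) (by
      unfold Int.fract at h
      rw [abs_le]; constructor <;> linarith)
    calc (1 : ℝ) = 4 / H * (H / 4) := by field_simp
      _ ≤ _ := by gcongr
  · positivity

lemma exists_fejer_majorant_Fdelta {Δ : ℝ} (hΔ : 0 < Δ) :
    ∃ H : ℕ, 1 ≤ H ∧ ((H : ℝ) ≤ 1 / Δ ∨ H = 1) ∧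
      ∀ θ, |Fdelta Δ θ - 2 * Δ| ≤ 48 * Δ * (fejer H θ + 1) := by
  rcases le_or_gt Δ (1 / 6) with h | h
  · have h1 : 1 ≤ 1 / (6 * Δ) := by rw [le_div_iff₀ (by positivity)]; linarith
    have hH1 : 1 ≤ ⌊1 / (6 * Δ)⌋₊ := Nat.le_floor (by simpa using h1)
    have hH2 : (⌊1 / (6 * Δ)⌋₊ : ℝ) ≤ 1 / (6 * Δ) := Nat.floor_le (by positivity)
    have hH3 := Nat.lt_floor_add_one (1 / (6 * Δ))
    generalize ⌊1 / (6 * Δ)⌋₊ = H at *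
    have hH0 : (1 : ℝ) ≤ H := by exact_mod_cast hH1
    refine ⟨H, hH1, Or.inl (hH2.trans ?_), fun θ => ?_⟩
    · exact one_div_le_one_div_of_le hΔ (by linarith)
    · have hf := Fdelta_le_fejer hH1 (Δ := Δ) (by
        rw [le_div_iff₀ (by positivity)] at hH2 ⊢; linarith) θ
      have h2 : 4 / (H : ℝ) ≤ 48 * Δ := by
        rw [div_lt_iff₀ (by positivity)] at hH3
        rw [div_le_iff₀ (by positivity)]
        nlinarith
      have h3 : 4 / H * fejer H θ ≤ 48 * Δ * fejer H θ :=
        mul_le_mul_of_nonneg_right h2 (fejer_nonneg _ _)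
      have h4 : 0 ≤ 48 * Δ * fejer H θ := mul_nonneg (by positivity) (fejer_nonneg _ _)
      have := Fdelta_nonneg Δ θ
      rw [abs_le]
      constructor <;> linarith
  · refine ⟨1, le_rfl, Or.inr rfl, fun θ => ?_⟩
    rw [fejer_one, abs_le]
    have := Fdelta_nonneg Δ θ
    have := Fdelta_le_one Δ θ
    constructor <;> linarith

lemma add_one_rpow_sub_rpow_le {γ : ℝ} (hγ1 : 0 ≤ γ) (hγ2 : γ ≤ 1) {x : ℝ} (hx : 0 < x) :
    (x + 1) ^ γ - x ^ γ ≤ x ^ (γ - 1) := by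
  have h1 : (1 + 1 / x) ^ γ ≤ 1 + γ * (1 / x) :=
    rpow_one_add_le_one_add_mul_self (by
      have : 0 < 1 / x := by positivity
      linarith) hγ1 hγ2
  calc (x + 1) ^ γ - x ^ γ = x ^ γ * (1 + 1 / x) ^ γ - x ^ γ := by
        rw [← Real.mul_rpow hx.le (by positivity)]
        congr 2
        field_simp
    _ ≤ x ^ γ * (1 + γ * (1 / x)) - x ^ γ := by gcongr
    _ = γ * x ^ (γ - 1) := by rw [Real.rpow_sub_one hx.ne']; ring
    _ ≤ 1 * x ^ (γ - 1) := by gcongr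
    _ = _ := one_mul _

lemma exists_fejer_majorant_psi {γ : ℝ} (hγ1 : 0 ≤ γ) (hγ2 : γ < 1) {U : ℕ} (hU : 1 ≤ U)
    (hU6 : 6 ≤ (U : ℝ) ^ (1 - γ)) :
    ∃ H : ℕ, 1 ≤ H ∧ (H : ℝ) ≤ (U : ℝ) ^ (1 - γ) ∧ ∀ n : ℕ, U ≤ n →
      |psi (-(((n : ℝ) + 1) ^ γ)) - psi (-((n : ℝ) ^ γ))| ≤
        48 * (U : ℝ) ^ (γ - 1) * (fejer H ((n : ℝ) ^ γ) + 1) := by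
  have hU0 : (0 : ℝ) < U := by exact_mod_cast hU
  have hinv : (U : ℝ) ^ (γ - 1) = 1 / (U : ℝ) ^ (1 - γ) := by
    rw [one_div, ← Real.rpow_neg hU0.le]; congr 1; ring
  rw [hinv]
  generalize hT : (U : ℝ) ^ (1 - γ) = T at *
  have hH1 : 1 ≤ ⌊T / 6⌋₊ := Nat.le_floor (by push_cast; linarith)
  have hH2 : (⌊T / 6⌋₊ : ℝ) ≤ T / 6 := Nat.floor_le (by linarith)
  have hH3 := Nat.lt_floor_add_one (T / 6)
  generalize ⌊T / 6⌋₊ = H at *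
  have hH0 : (1 : ℝ) ≤ H := by exact_mod_cast hH1
  refine ⟨H, hH1, by linarith, fun n hn => ?_⟩
  have hn0 : (U : ℝ) ≤ n := by exact_mod_cast hn
  have hT0 : 0 < T := by linarith
  have hδ : ((n : ℝ) + 1) ^ γ - (n : ℝ) ^ γ ≤ 1 / T := by
    refine (add_one_rpow_sub_rpow_le hγ1 hγ2.le (hU0.trans_le hn0)).trans ?_
    rw [← hinv]
    exact Real.rpow_le_rpow_of_nonpos hU0 hn0 (by linarith)
  have h1 := abs_psi_neg_sub_psi_neg_le hH1
    (Real.rpow_le_rpow (Nat.cast_nonneg n) (by linarith : (n : ℝ) ≤ n + 1) hγ1)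
    (hδ.trans (one_div_le_one_div_of_le (by positivity) (by linarith)))
  have h2 : 4 / (H : ℝ) ≤ 48 * (1 / T) := by
    rw [mul_one_div, div_le_div_iff₀ (by positivity) hT0]
    linarith
  have h3 := mul_le_mul_of_nonneg_right h2 (fejer_nonneg H ((n : ℝ) ^ γ))
  have h4 : 0 < 1 / T := by positivity
  linarith

lemma sum_Ico_rpow_sub_one_le {γ : ℝ} (hγ1 : 1 / 2 ≤ γ) (hγ2 : γ ≤ 1) (J : ℕ) :
    ∑ j ∈ Ico 1 (J + 1), (j : ℝ) ^ (γ - 1) ≤ 2 * (J : ℝ) ^ γ := by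
  induction J with
  | zero => simp [Real.zero_rpow (by linarith : γ ≠ 0)]
  | succ J ih =>
    rw [sum_Ico_succ_top (by omega)]
    have hx : (0 : ℝ) < ((J + 1 : ℕ) : ℝ) := by positivity
    set x : ℝ := ((J + 1 : ℕ) : ℝ) with hxdef
    have hJ : (J : ℝ) = x * (1 + -(1 / x)) := by
      have : (J : ℝ) = x - 1 := by rw [hxdef]; push_cast; ring
      rw [this]; field_simp; ring
    have hx1 : 1 / x ≤ 1 := by
      rw [div_le_one hx, hxdef]; push_cast; linarith [(Nat.cast_nonneg J : (0 : ℝ) ≤ J)]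
    have hb : (1 + -(1 / x)) ^ γ ≤ 1 + γ * -(1 / x) :=
      rpow_one_add_le_one_add_mul_self (by linarith) (by linarith) hγ2
    have h1 : (J : ℝ) ^ γ ≤ x ^ γ - γ * x ^ (γ - 1) := by
      rw [hJ, Real.mul_rpow hx.le (by linarith), Real.rpow_sub_one hx.ne']
      calc x ^ γ * (1 + -(1 / x)) ^ γ ≤ x ^ γ * (1 + γ * -(1 / x)) := by gcongr
        _ = _ := by ring
    have h2 : 0 < x ^ (γ - 1) := by positivity
    nlinarith

lemma sum_primes_le_sum_blocks {g : ℕ → ℝ} (hg : ∀ n, 0 ≤ g n) (M Y j₀ : ℕ) (hY : 0 < Y) :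
    ∑ p ∈ (range (M + 1)).filter Nat.Prime, g p ≤
      ∑ p ∈ (Icc 1 (min M (j₀ * Y))), g p +
      ∑ j ∈ Ico j₀ (M / Y + 1), ∑ p ∈ (Ioc (j * Y) ((j + 1) * Y)).filter Nat.Prime, g p := by
  rw [← sum_filter_add_sum_filter_not _ (fun p => p ≤ j₀ * Y)]
  refine add_le_add ?_ ?_
  · refine sum_le_sum_of_subset_of_nonneg ?_ fun n _ _ => hg n
    intro p hp
    simp only [mem_filter, mem_range] at hp
    rw [mem_Icc]
    exact ⟨hp.1.2.pos, le_min (by omega) hp.2⟩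
  · rw [← sum_fiberwise_of_maps_to (t := Ico j₀ (M / Y + 1)) (g := fun p => (p - 1) / Y)]
    · refine sum_le_sum fun j _ => sum_le_sum_of_subset_of_nonneg ?_ fun n _ _ => hg n
      intro p hp
      simp only [mem_filter, mem_range, not_le] at hp
      obtain ⟨⟨⟨h1, h2⟩, h3⟩, rfl⟩ := hp
      have hp0 := h2.pos
      rw [mem_filter, mem_Ioc]
      have e1 := Nat.div_mul_le_self (p - 1) Y
      have e2 := Nat.lt_mul_of_div_lt (Nat.lt_succ_self ((p - 1) / Y)) hY
      rw [Nat.succ_eq_add_one] at e2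
      exact ⟨⟨by omega, by omega⟩, h2⟩
    · intro p hp
      simp only [mem_filter, mem_range, not_le] at hp
      obtain ⟨⟨h1, h2⟩, h3⟩ := hp
      rw [mem_Ico]
      constructor
      · rw [Nat.le_div_iff_mul_le hY]; omega
      · rw [Nat.lt_succ_iff]
        exact Nat.div_le_div_right (by omega)

/-- The terms of `Γ₂` over primes in a short block. -/
lemma sum_block_psi_Fdelta_le {γ : ℝ} (hγ1 : 13 / 14 < γ) (hγ2 : γ < 1) :
    ∃ K > 0, ∃ N₀ ≥ (1 : ℝ), ∀ N ≥ N₀, ∀ (α β : ℝ) (a : ℤ) (q : ℕ), Int.gcd a q = 1 →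
      |α - a / q| < 1 / (q : ℝ) ^ 2 → N ^ (0.9 : ℝ) ≤ q → (q : ℝ) ≤ N →
      ∀ (U V : ℕ) (Δ : ℝ), N ^ (0.925 : ℝ) ≤ U → (U : ℝ) ≤ N → U ≤ V →
      (V : ℝ) - U ≤ 2 * N ^ (0.9 : ℝ) → N ^ (-(1 / 29) : ℝ) ≤ Δ →
      ∑ p ∈ (Ioc U V).filter Nat.Prime,
        |(psi (-(((p : ℝ) + 1) ^ γ)) - psi (-((p : ℝ) ^ γ))) *
          (Fdelta Δ (α * (p : ℝ) ^ 2 + β) - 2 * Δ) * Real.log p| ≤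
          K * N ^ (0.9 : ℝ) * (U : ℝ) ^ (γ - 1) * Δ := by
  obtain ⟨K, hK, N₀, hN₀, H⟩ := sum_primes_fejer_le hγ1 hγ2
  refine ⟨48 * 48 * (4 * K), by positivity, max N₀ ((6 : ℝ) ^ (1 / (0.925 * (1 - γ)))),
    hN₀.trans (le_max_left _ _), ?_⟩
  intro N hN' α β a q hco hα hq1 hq2 U V Δ hU1 hU2 hUV hVU hΔ
  have hN : N₀ ≤ N := (le_max_left _ _).trans hN'
  have hN6 : (6 : ℝ) ^ (1 / (0.925 * (1 - γ))) ≤ N := (le_max_right _ _).trans hN'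
  have hN1 : 1 ≤ N := hN₀.trans hN
  have hN0 : 0 < N := by linarith
  have hγ : 0 < 1 - γ := by linarith
  have hU1' : (1 : ℝ) ≤ U := (Real.one_le_rpow hN1 (by norm_num)).trans hU1
  have hU0 : 1 ≤ U := by exact_mod_cast hU1'
  have hU6 : 6 ≤ (U : ℝ) ^ (1 - γ) := by
    calc (6 : ℝ) = ((6 : ℝ) ^ (1 / (0.925 * (1 - γ)))) ^ (0.925 * (1 - γ)) := by
          rw [← Real.rpow_mul (by norm_num), one_div_mul_cancel (by positivity), Real.rpow_one]
      _ ≤ N ^ (0.925 * (1 - γ)) := Real.rpow_le_rpow (by positivity) hN6 (by positivity)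
      _ = (N ^ (0.925 : ℝ)) ^ (1 - γ) := Real.rpow_mul hN0.le _ _
      _ ≤ _ := Real.rpow_le_rpow (by positivity) hU1 hγ.le
  have hΔ0 : 0 < Δ := lt_of_lt_of_le (by positivity) hΔ
  obtain ⟨H₁, hH1, hH1', hpsi⟩ := exists_fejer_majorant_psi (by linarith) hγ2 hU0 hU6
  obtain ⟨H₂, hH2, hH2', hF⟩ := exists_fejer_majorant_Fdelta hΔ0
  have hone : (1 : ℝ) ≤ N ^ (1 / 29 : ℝ) := Real.one_le_rpow hN1 (by norm_num)
  have hH2N : (H₂ : ℝ) ≤ N ^ (1 / 29 : ℝ) := by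
    rcases hH2' with h | h
    · refine h.trans ?_
      calc 1 / Δ ≤ 1 / N ^ (-(1 / 29) : ℝ) := one_div_le_one_div_of_le (by positivity) hΔ
        _ = _ := by rw [Real.rpow_neg hN0.le]; simp
    · rw [h]; simpa using hone
  have hsum := fun G₁ G₂ : ℕ => H N hN α β a q hco hα hq1 hq2 U V G₁ G₂ hU1 hU2 hUV hVU
  have one1 : ((1 : ℕ) : ℝ) ≤ (U : ℝ) ^ (1 - γ) := by push_cast; linarith
  have one2 : ((1 : ℕ) : ℝ) ≤ N ^ (1 / 29 : ℝ) := by simpa using hone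
  have s1 := hsum H₁ H₂ hH1 hH1' hH2 hH2N
  have s2 := hsum H₁ 1 hH1 hH1' le_rfl one2
  have s3 := hsum 1 H₂ le_rfl one1 hH2 hH2N
  have s4 := hsum 1 1 le_rfl one1 le_rfl one2
  calc _ ≤ ∑ p ∈ (Ioc U V).filter Nat.Prime, 48 * (U : ℝ) ^ (γ - 1) * (48 * Δ) *
        (fejer H₁ ((p : ℝ) ^ γ) * fejer H₂ (α * (p : ℝ) ^ 2 + β) * Real.log p +
          fejer H₁ ((p : ℝ) ^ γ) * fejer 1 (α * (p : ℝ) ^ 2 + β) * Real.log p +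
          fejer 1 ((p : ℝ) ^ γ) * fejer H₂ (α * (p : ℝ) ^ 2 + β) * Real.log p +
          fejer 1 ((p : ℝ) ^ γ) * fejer 1 (α * (p : ℝ) ^ 2 + β) * Real.log p) := by
        refine sum_le_sum fun p hp => ?_
        rw [mem_filter, mem_Ioc] at hp
        have h1 := hpsi p hp.1.1.le
        have h2 := hF (α * (p : ℝ) ^ 2 + β)
        have h3 : 0 ≤ Real.log p := Real.log_natCast_nonneg p
        rw [abs_mul, abs_mul, abs_of_nonneg h3]
        calc _ ≤ 48 * (U : ℝ) ^ (γ - 1) * (fejer H₁ ((p : ℝ) ^ γ) + 1) *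
              (48 * Δ * (fejer H₂ (α * (p : ℝ) ^ 2 + β) + 1)) * Real.log p := by
              refine mul_le_mul_of_nonneg_right ?_ h3
              exact mul_le_mul h1 h2 (abs_nonneg _) ((abs_nonneg _).trans h1)
          _ = _ := by simp only [fejer_one]; ring
    _ ≤ 48 * (U : ℝ) ^ (γ - 1) * (48 * Δ) * (K * N ^ (0.9 : ℝ) + K * N ^ (0.9 : ℝ) +
          K * N ^ (0.9 : ℝ) + K * N ^ (0.9 : ℝ)) := by
        rw [← mul_sum, sum_add_distrib, sum_add_distrib, sum_add_distrib]
        refine mul_le_mul_of_nonneg_left ?_ (by positivity)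
        linarith
    _ = _ := by ring

lemma sum_primes_psi_Fdelta_le {γ : ℝ} (hγ1 : 13 / 14 < γ) (hγ2 : γ < 1) :
    ∃ K > 0, ∃ N₀ ≥ (1 : ℝ), ∀ N ≥ N₀, ∀ (α β : ℝ) (a : ℤ) (q : ℕ), Int.gcd a q = 1 →
      |α - a / q| < 1 / (q : ℝ) ^ 2 → N ^ (0.9 : ℝ) ≤ q → (q : ℝ) ≤ N →
      ∀ Δ : ℝ, N ^ (-(1 / 29) : ℝ) ≤ Δ →
      ∑ p ∈ (range (⌊N⌋₊ + 1)).filter Nat.Prime,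
        |(psi (-(((p : ℝ) + 1) ^ γ)) - psi (-((p : ℝ) ^ γ))) *
          (Fdelta Δ (α * (p : ℝ) ^ 2 + β) - 2 * Δ) * Real.log p| ≤
          K * (N ^ γ * Δ + N ^ (0.926 : ℝ)) := by
  obtain ⟨K, hK, N₀, hN₀, H⟩ := sum_block_psi_Fdelta_le hγ1 hγ2
  refine ⟨8000 + 2 * K, by positivity, N₀, hN₀, ?_⟩
  intro N hN α β a q hco hα hq1 hq2 Δ hΔ
  have hN1 : 1 ≤ N := hN₀.trans hN
  have hN0 : 0 < N := by linarith
  have hΔ0 : 0 < Δ := lt_of_lt_of_le (by positivity) hΔ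
  have m : ∀ {x y : ℝ}, x ≤ y → N ^ x ≤ N ^ y := fun h => Real.rpow_le_rpow_of_exponent_le hN1 h
  have o : ∀ {x : ℝ}, 0 ≤ x → 1 ≤ N ^ x := fun h => Real.one_le_rpow hN1 h
  have hceil : ∀ {x : ℝ}, 0 ≤ x → (⌈N ^ x⌉₊ : ℝ) ≤ 2 * N ^ x := fun {x} h => by
    have := (Nat.ceil_lt_add_one (by positivity : 0 ≤ N ^ x)).le
    linarith [o h]
  set Y := ⌈N ^ (0.9 : ℝ)⌉₊ with hY
  set j₀ := ⌈N ^ (0.025 : ℝ)⌉₊ with hj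
  have hY1 : N ^ (0.9 : ℝ) ≤ Y := Nat.le_ceil _
  have hY2 : (Y : ℝ) ≤ 2 * N ^ (0.9 : ℝ) := hceil (by norm_num)
  have hj1 : N ^ (0.025 : ℝ) ≤ j₀ := Nat.le_ceil _
  have hj2 : (j₀ : ℝ) ≤ 2 * N ^ (0.025 : ℝ) := hceil (by norm_num)
  have hY0' : (0 : ℝ) < Y := lt_of_lt_of_le (by positivity) hY1
  have hY0 : 0 < Y := by exact_mod_cast hY0'
  have hj0' : (0 : ℝ) < j₀ := lt_of_lt_of_le (by positivity) hj1
  have hj0 : 0 < j₀ := by exact_mod_cast hj0'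
  have hM : (⌊N⌋₊ : ℝ) ≤ N := Nat.floor_le hN0.le
  have hJ : ((⌊N⌋₊ / Y : ℕ) : ℝ) * Y ≤ N := by
    refine le_trans ?_ hM
    exact_mod_cast Nat.div_mul_le_self _ _
  have h925 : N ^ (0.025 : ℝ) * N ^ (0.9 : ℝ) = N ^ (0.925 : ℝ) := by
    rw [← Real.rpow_add hN0]; norm_num
  have hlogN : Real.log N ≤ 1000 * N ^ (0.001 : ℝ) := by
    have h3 := Real.log_le_rpow_div hN0.le (by norm_num : (0 : ℝ) < 0.001)
    have h4 : N ^ (0.001 : ℝ) / 0.001 = 1000 * N ^ (0.001 : ℝ) := by ring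
    linarith
  refine (sum_primes_le_sum_blocks (g := fun p : ℕ =>
    |(psi (-(((p : ℝ) + 1) ^ γ)) - psi (-((p : ℝ) ^ γ))) *
      (Fdelta Δ (α * (p : ℝ) ^ 2 + β) - 2 * Δ) * Real.log p|)
    (fun n => abs_nonneg _) ⌊N⌋₊ Y j₀ hY0).trans ?_
  have small : ∑ p ∈ Icc 1 (min ⌊N⌋₊ (j₀ * Y)),
      |(psi (-(((p : ℝ) + 1) ^ γ)) - psi (-((p : ℝ) ^ γ))) *
        (Fdelta Δ (α * (p : ℝ) ^ 2 + β) - 2 * Δ) * Real.log p| ≤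
      4000 * N ^ (0.926 : ℝ) * (1 + 2 * Δ) := by
    have hterm : ∀ p ∈ Icc 1 (min ⌊N⌋₊ (j₀ * Y)),
        |(psi (-(((p : ℝ) + 1) ^ γ)) - psi (-((p : ℝ) ^ γ))) *
          (Fdelta Δ (α * (p : ℝ) ^ 2 + β) - 2 * Δ) * Real.log p| ≤
        1 * (1 + 2 * Δ) * (1000 * N ^ (0.001 : ℝ)) := by
      intro p hp
      rw [mem_Icc, le_min_iff] at hp
      have hp0 : (0 : ℝ) < p := by exact_mod_cast hp.1
      have hpN : (p : ℝ) ≤ N := le_trans (by exact_mod_cast hp.2.1) hM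
      rw [abs_mul, abs_mul, abs_of_nonneg (Real.log_natCast_nonneg p)]
      have h1 := abs_psi_sub_psi_le_one (-(((p : ℝ) + 1) ^ γ)) (-((p : ℝ) ^ γ))
      have h2 : |Fdelta Δ (α * (p : ℝ) ^ 2 + β) - 2 * Δ| ≤ 1 + 2 * Δ := by
        have := Fdelta_nonneg Δ (α * (p : ℝ) ^ 2 + β)
        have := Fdelta_le_one Δ (α * (p : ℝ) ^ 2 + β)
        rw [abs_le]; constructor <;> linarith
      exact mul_le_mul (mul_le_mul h1 h2 (abs_nonneg _) (by norm_num))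
        ((Real.log_le_log hp0 hpN).trans hlogN) (Real.log_natCast_nonneg p) (by positivity)
    refine (sum_le_card_nsmul _ _ _ hterm).trans ?_
    rw [Nat.card_Icc, Nat.add_sub_cancel, nsmul_eq_mul]
    have hcard : ((min ⌊N⌋₊ (j₀ * Y) : ℕ) : ℝ) ≤ 4 * N ^ (0.925 : ℝ) := by
      calc ((min ⌊N⌋₊ (j₀ * Y) : ℕ) : ℝ) ≤ ((j₀ * Y : ℕ) : ℝ) := by
            exact_mod_cast min_le_right _ _
        _ = j₀ * Y := by push_cast; ring
        _ ≤ 2 * N ^ (0.025 : ℝ) * (2 * N ^ (0.9 : ℝ)) := by gcongr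
        _ = _ := by rw [← h925]; ring
    calc _ ≤ 4 * N ^ (0.925 : ℝ) * (1 * (1 + 2 * Δ) * (1000 * N ^ (0.001 : ℝ))) := by gcongr
      _ = 4000 * (N ^ (0.925 : ℝ) * N ^ (0.001 : ℝ)) * (1 + 2 * Δ) := by ring
      _ = _ := by rw [← Real.rpow_add hN0]; norm_num
  have large : ∑ j ∈ Ico j₀ (⌊N⌋₊ / Y + 1),
      ∑ p ∈ (Ioc (j * Y) ((j + 1) * Y)).filter Nat.Prime,
        |(psi (-(((p : ℝ) + 1) ^ γ)) - psi (-((p : ℝ) ^ γ))) *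
          (Fdelta Δ (α * (p : ℝ) ^ 2 + β) - 2 * Δ) * Real.log p| ≤ 2 * K * (N ^ γ * Δ) := by
    calc _ ≤ ∑ j ∈ Ico j₀ (⌊N⌋₊ / Y + 1), K * Δ * (Y : ℝ) ^ γ * (j : ℝ) ^ (γ - 1) := by
          refine sum_le_sum fun j hj' => ?_
          rw [mem_Ico] at hj'
          have hjj : (j₀ : ℝ) ≤ j := by exact_mod_cast hj'.1
          have hjJ : (j : ℝ) ≤ ((⌊N⌋₊ / Y : ℕ) : ℝ) := by exact_mod_cast Nat.lt_succ_iff.mp hj'.2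
          refine (H N hN α β a q hco hα hq1 hq2 (j * Y) ((j + 1) * Y) Δ ?_ ?_ ?_ ?_ hΔ).trans ?_
          · rw [← h925]
            push_cast
            exact mul_le_mul (hj1.trans hjj) hY1 (by positivity) (by positivity)
          · push_cast
            exact le_trans (by gcongr) hJ
          · exact Nat.mul_le_mul_right _ (Nat.le_succ j)
          · push_cast
            linarith
          · push_cast
            rw [Real.mul_rpow (Nat.cast_nonneg _) hY0'.le]
            calc _ ≤ K * Y * ((j : ℝ) ^ (γ - 1) * (Y : ℝ) ^ (γ - 1)) * Δ := by gcongr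
              _ = _ := by
                rw [Real.rpow_sub_one hY0'.ne']
                field_simp
      _ ≤ ∑ j ∈ Ico 1 (⌊N⌋₊ / Y + 1), K * Δ * (Y : ℝ) ^ γ * (j : ℝ) ^ (γ - 1) := by
          refine sum_le_sum_of_subset_of_nonneg (Ico_subset_Ico_left hj0) fun j _ _ => ?_
          positivity
      _ ≤ K * Δ * (Y : ℝ) ^ γ * (2 * ((⌊N⌋₊ / Y : ℕ) : ℝ) ^ γ) := by
          rw [← mul_sum]
          exact mul_le_mul_of_nonneg_left
            (sum_Ico_rpow_sub_one_le (by linarith) hγ2.le _) (by positivity)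
      _ = 2 * K * (((((⌊N⌋₊ / Y : ℕ) : ℝ) * Y) ^ γ) * Δ) := by
          rw [Real.mul_rpow (Nat.cast_nonneg _) hY0'.le]; ring
      _ ≤ _ := by gcongr
  refine (add_le_add small large).trans ?_
  have h926 : N ^ (0.926 : ℝ) * Δ ≤ N ^ γ * Δ :=
    mul_le_mul_of_nonneg_right (m (by linarith)) hΔ0.le
  have : 0 < N ^ (0.926 : ℝ) := by positivity
  nlinarith [mul_pos hK this]

end

theorem Gamma2_bound (γ ε : ℝ) (hγ1 : 13 / 14 < γ) (hγ2 : γ < 1) (hε : 0 < ε) :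
    ∃ C₀ > 0, ∀ C ≥ C₀, ∃ K > 0, ∃ q₀ : ℕ, ∀ (α β : ℝ) (a : ℤ) (q : ℕ),
      Irrational α → q₀ ≤ q → 2 ≤ q → Int.gcd a (q : ℤ) = 1 → a ≠ 0 →
      |α - (a : ℝ) / (q : ℝ)| < 1 / (q : ℝ) ^ 2 →
      |∑ p ∈ (Finset.range (⌊(q : ℝ) ^ (29 / (55 - 28 * γ))⌋₊ + 1)).filter Nat.Prime,
          (psi (-(((p : ℝ) + 1) ^ γ)) - psi (-((p : ℝ) ^ γ))) *
            (Fdelta (C * ((q : ℝ) ^ (29 / (55 - 28 * γ))) ^ ((13 - 14 * γ) / 29 + ε))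
                (α * (p : ℝ) ^ 2 + β) -
              2 * (C * ((q : ℝ) ^ (29 / (55 - 28 * γ))) ^ ((13 - 14 * γ) / 29 + ε))) *
            Real.log p| ≤
        K * ((q : ℝ) ^ (29 / (55 - 28 * γ))) ^ ((15 * γ + 13) / 29 + ε) := by
  obtain ⟨K, hK, N₀, hN₀, H⟩ := sum_primes_psi_Fdelta_le hγ1 hγ2
  refine ⟨1, one_pos, fun C hC => ⟨K * (C + 1), mul_pos hK (by linarith), ⌈N₀⌉₊, ?_⟩⟩
  intro α β a q _ hq hq2 hco _ hα
  have hq1 : (1 : ℝ) ≤ q := by exact_mod_cast (by omega : 1 ≤ q)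
  have hden : 0 < 55 - 28 * γ := by linarith
  have hqN : (q : ℝ) ≤ (q : ℝ) ^ (29 / (55 - 28 * γ)) :=
    Real.self_le_rpow_of_one_le hq1 (by rw [le_div_iff₀ hden]; linarith)
  have hNq : ((q : ℝ) ^ (29 / (55 - 28 * γ))) ^ (0.9 : ℝ) ≤ q := by
    rw [← Real.rpow_mul (by linarith)]
    conv_rhs => rw [← Real.rpow_one (q : ℝ)]
    refine Real.rpow_le_rpow_of_exponent_le hq1 ?_
    rw [div_mul_eq_mul_div, div_le_one hden]
    linarith
  have hN : N₀ ≤ (q : ℝ) ^ (29 / (55 - 28 * γ)) := (Nat.ceil_le.mp hq).trans hqN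
  generalize (q : ℝ) ^ (29 / (55 - 28 * γ)) = N at *
  have hN1 : 1 ≤ N := hN₀.trans hN
  have hN0 : 0 < N := by linarith
  have m : ∀ {x y : ℝ}, x ≤ y → N ^ x ≤ N ^ y := fun h => Real.rpow_le_rpow_of_exponent_le hN1 h
  refine (Finset.abs_sum_le_sum_abs _ _).trans
    ((H N hN α β a q hco hα hNq hqN (C * N ^ ((13 - 14 * γ) / 29 + ε)) ?_).trans ?_)
  · calc N ^ (-(1 / 29) : ℝ) ≤ 1 * N ^ ((13 - 14 * γ) / 29 + ε) := by
          rw [one_mul]; exact m (by linarith)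
      _ ≤ _ := by gcongr
  · have h1 : N ^ γ * (C * N ^ ((13 - 14 * γ) / 29 + ε)) =
        C * N ^ ((15 * γ + 13) / 29 + ε) := by
      rw [mul_left_comm, ← Real.rpow_add hN0]
      congr 2
      ring
    have h2 : N ^ (0.926 : ℝ) ≤ N ^ ((15 * γ + 13) / 29 + ε) := m (by linarith)
    rw [h1, mul_assoc]
    refine mul_le_mul_of_nonneg_left ?_ hK.le
    linarith
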